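/- arXiv:1605.01009 — 3 statements merged into one kernel-verified Lean document; each statement's English description precedes it below -/
import Mathlib

section
/- Let K be a real symmetric positive definite d×d matrix and let (ε_N)_{N≥1} be positive reals with N ε_N² → ∞ and N ε_N³ → 0 as N → ∞ (hence ε_N → 0). Let 0 < a ≤ b and for each N let A_N be a subset of the rescaled lattice (N⁻¹ℤ)ᵈ with {x ∈ (N⁻¹ℤ)ᵈ : |x| ≤ a ε_N} ⊆ A_N ⊆ {x ∈ (N⁻¹ℤ)ᵈ : |x| ≤ b ε_N}. Then lim_{N→∞} √(det K) · (2πN)^{−d/2} · ∑_{x ∈ A_N} exp(−(N/2) xᵀKx) = 1. -/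
open Matrix Filter
open MeasureTheory

lemma gls_factor {d : ℕ} (K : Matrix (Fin d) (Fin d) ℝ) (hK : K.PosDef) :
    ∃ B : Matrix (Fin d) (Fin d) ℝ, K = Bᵀ * B ∧ B.det ≠ 0 := by
  obtain ⟨B, hB⟩ : ∃ B : Matrix (Fin d) (Fin d) ℝ, K = Bᴴ * B := by
    open scoped MatrixOrder in
    exact CStarAlgebra.nonneg_iff_eq_star_mul_self.mp hK.posSemidef.nonneg
  rw [conjTranspose_eq_transpose_of_trivial] at hB
  refine ⟨B, hB, fun h => ?_⟩
  have := hK.det_pos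
  rw [hB, det_mul, h] at this
  simp at this

lemma gls_quad {d : ℕ} (B : Matrix (Fin d) (Fin d) ℝ) (x : Fin d → ℝ) :
    x ⬝ᵥ ((Bᵀ * B) *ᵥ x) = ∑ i, (B *ᵥ x) i ^ 2 := by
  rw [← mulVec_mulVec, dotProduct_mulVec, vecMul_transpose]
  simp [dotProduct, sq]

lemma gls_coercive {d : ℕ} (K : Matrix (Fin d) (Fin d) ℝ) (hK : K.PosDef) :
    ∃ c : ℝ, 0 < c ∧ ∀ x : Fin d → ℝ, c * ∑ i, x i ^ 2 ≤ x ⬝ᵥ (K *ᵥ x) := by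
  obtain ⟨B, rfl, hB⟩ := gls_factor K hK
  set M : ℝ := ∑ i, ∑ j, (B⁻¹ i j) ^ 2 with hM
  have hM0 : 0 ≤ M := by positivity
  refine ⟨(M + 1)⁻¹, by positivity, fun x => ?_⟩
  rw [gls_quad, inv_mul_le_iff₀ (by positivity)]
  have h1 : ∀ i, x i ^ 2 ≤ (∑ j, (B⁻¹ i j) ^ 2) * ∑ j, (B *ᵥ x) j ^ 2 := by
    intro i
    have hx : x i = ∑ j, B⁻¹ i j * (B *ᵥ x) j := by
      have : B⁻¹ *ᵥ (B *ᵥ x) = x := by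
        rw [mulVec_mulVec, nonsing_inv_mul _ (isUnit_iff_ne_zero.2 hB), one_mulVec]
      conv_lhs => rw [← this]
      rfl
    rw [hx]
    exact Finset.sum_mul_sq_le_sq_mul_sq _ _ _
  calc ∑ i, x i ^ 2 ≤ ∑ i, (∑ j, (B⁻¹ i j) ^ 2) * ∑ j, (B *ᵥ x) j ^ 2 :=
        Finset.sum_le_sum fun i _ => h1 i
    _ = M * ∑ j, (B *ᵥ x) j ^ 2 := by rw [hM, Finset.sum_mul]
    _ ≤ _ := by gcongr; linarith

lemma gls_integral {d : ℕ} (K : Matrix (Fin d) (Fin d) ℝ) (hK : K.PosDef) :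
    ∫ u : Fin d → ℝ, Real.exp (-(1/2) * (u ⬝ᵥ (K *ᵥ u)))
      = (2 * Real.pi) ^ ((d : ℝ) / 2) / Real.sqrt K.det := by
  obtain ⟨B, rfl, hB⟩ := gls_factor K hK
  have h0 : ∫ y : Fin d → ℝ, Real.exp (-(1/2) * ∑ i, y i ^ 2) =
      (2 * Real.pi) ^ ((d : ℝ) / 2) := by
    have : ∀ y : Fin d → ℝ, Real.exp (-(1/2) * ∑ i, y i ^ 2)
        = ∏ i, Real.exp (-(1/2) * y i ^ 2) := by
      intro y; rw [Finset.mul_sum, Real.exp_sum]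
    simp_rw [this]
    rw [integral_fintype_prod_volume_eq_pow (fun t : ℝ => Real.exp (-(1/2) * t ^ 2)),
      integral_gaussian, Fintype.card_fin, Real.sqrt_eq_rpow, ← Real.rpow_mul_natCast (by positivity)]
    congr 1 <;> ring
  have h1 := integral_map_of_stronglyMeasurable (μ := (volume : Measure (Fin d → ℝ)))
    (φ := toLin' B) (LinearMap.continuous_of_finiteDimensional _).measurable
    (f := fun y : Fin d → ℝ => Real.exp (-(1/2) * ∑ i, y i ^ 2))
    (by apply Continuous.stronglyMeasurable; fun_prop)
  rw [Real.map_matrix_volume_pi_eq_smul_volume_pi hB, integral_smul_measure, h0] at h1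
  simp_rw [gls_quad]
  simp only [toLin'_apply] at h1
  rw [← h1, det_mul, det_transpose, Real.sqrt_mul_self_eq_abs, ENNReal.toReal_ofReal (abs_nonneg _),
    abs_inv, smul_eq_mul]
  ring

/-- The lattice point below `u` at scale `N`, in unscaled coordinates. -/
noncomputable def glsPt {d : ℕ} (N : ℕ) (u : Fin d → ℝ) : Fin d → ℝ :=
  fun i => (⌊Real.sqrt N * u i⌋ : ℝ) / N

/-- The cell of the point `x`, in coordinates scaled by `√N`. -/
def glsCube {d : ℕ} (N : ℕ) (x : Fin d → ℝ) : Set (Fin d → ℝ) :=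
  Set.pi Set.univ fun i => Set.Ico (Real.sqrt N * x i) (Real.sqrt N * x i + (Real.sqrt N)⁻¹)

lemma gls_mem_cube {d : ℕ} {N : ℕ} (hN : 0 < N) (x u : Fin d → ℝ)
    (hx : ∀ i, ∃ k : ℤ, x i = k / N) : u ∈ glsCube N x ↔ x = glsPt N u := by
  have hN' : (0 : ℝ) < N := by exact_mod_cast hN
  have hs : 0 < Real.sqrt N := Real.sqrt_pos.2 hN'
  have hss : Real.sqrt N * Real.sqrt N = N := Real.mul_self_sqrt hN'.le
  rw [glsCube, Set.mem_univ_pi, funext_iff]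
  refine forall_congr' fun i => ?_
  obtain ⟨k, hk⟩ := hx i
  have e : Real.sqrt N * x i = k / Real.sqrt N := by
    rw [hk]; field_simp; rw [sq, hss, mul_comm]
  have e2 : Real.sqrt N * x i + (Real.sqrt N)⁻¹ = (k + 1) / Real.sqrt N := by
    rw [e]; field_simp
  rw [Set.mem_Ico, e2, e, div_le_iff₀ hs, lt_div_iff₀ hs, hk, glsPt, div_left_inj' hN'.ne',
    mul_comm (u i), Int.cast_inj, eq_comm, Int.floor_eq_iff]

/-- The step function whose integral is the rescaled lattice sum. -/
noncomputable def glsF {d : ℕ} (K : Matrix (Fin d) (Fin d) ℝ) (A : Finset (Fin d → ℝ)) (N : ℕ)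
    (u : Fin d → ℝ) : ℝ :=
  ∑ x ∈ A, (glsCube N x).indicator (fun _ => Real.exp (-(N : ℝ) / 2 * (x ⬝ᵥ (K *ᵥ x)))) u

lemma gls_cube_meas {d : ℕ} (N : ℕ) (x : Fin d → ℝ) : MeasurableSet (glsCube N x) :=
  MeasurableSet.univ_pi fun _ => measurableSet_Ico

lemma glsF_eq {d : ℕ} (K : Matrix (Fin d) (Fin d) ℝ) (A : Finset (Fin d → ℝ)) {N : ℕ}
    (hN : 0 < N) (hA : ∀ x ∈ A, ∀ i, ∃ k : ℤ, x i = k / N) (u : Fin d → ℝ) [Decidable (glsPt N u ∈ A)] :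
    glsF K A N u = if glsPt N u ∈ A then
      Real.exp (-(N : ℝ) / 2 * (glsPt N u ⬝ᵥ (K *ᵥ glsPt N u))) else 0 := by
  classical
  have : glsF K A N u = ∑ x ∈ A, if x = glsPt N u then
      Real.exp (-(N : ℝ) / 2 * (x ⬝ᵥ (K *ᵥ x))) else 0 := by
    refine Finset.sum_congr rfl fun x hx => ?_
    rw [Set.indicator_apply]
    exact if_congr (gls_mem_cube hN x u (hA x hx)) rfl rfl
  rw [this, Finset.sum_ite_eq']
  congr

lemma glsF_integral {d : ℕ} (K : Matrix (Fin d) (Fin d) ℝ) (A : Finset (Fin d → ℝ)) (N : ℕ) :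
    ∫ u, glsF K A N u = (Real.sqrt N)⁻¹ ^ d *
      ∑ x ∈ A, Real.exp (-(N : ℝ) / 2 * (x ⬝ᵥ (K *ᵥ x))) := by
  have hv : ∀ x : Fin d → ℝ, volume (glsCube N x) = ENNReal.ofReal ((Real.sqrt N)⁻¹) ^ d := by
    intro x
    rw [glsCube, Real.volume_pi_Ico]
    simp
  unfold glsF
  rw [integral_finsetSum, Finset.mul_sum]
  · refine Finset.sum_congr rfl fun x _ => ?_
    rw [integral_indicator_const _ (gls_cube_meas N x), measureReal_def, hv, ENNReal.toReal_pow,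
      ENNReal.toReal_ofReal (by positivity), smul_eq_mul]
  · intro x _
    refine (integrable_indicator_iff (gls_cube_meas N x)).2 (integrableOn_const ?_)
    rw [hv]; exact ENNReal.pow_ne_top ENNReal.ofReal_ne_top

lemma gls_floor_close {N : ℕ} (hN : 0 < N) (t : ℝ) :
    |Real.sqrt N * ((⌊Real.sqrt N * t⌋ : ℝ) / N) - t| ≤ (Real.sqrt N)⁻¹ := by
  have hN' : (0 : ℝ) < N := by exact_mod_cast hN
  have hs : 0 < Real.sqrt N := Real.sqrt_pos.2 hN'
  have hss : Real.sqrt N * Real.sqrt N = N := Real.mul_self_sqrt hN'.le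
  have e : Real.sqrt N * ((⌊Real.sqrt N * t⌋ : ℝ) / N) - t
      = (⌊Real.sqrt N * t⌋ - Real.sqrt N * t) * (Real.sqrt N)⁻¹ := by
    nth_rewrite 3 [← hss]
    field_simp
  rw [e, abs_mul, abs_of_pos (inv_pos.2 hs)]
  refine mul_le_of_le_one_left (inv_pos.2 hs).le ?_
  have h1 := Int.floor_le (Real.sqrt N * t)
  have h2 := Int.lt_floor_add_one (Real.sqrt N * t)
  rw [abs_le]; constructor <;> linarith

lemma gls_tendsto_pt {d : ℕ} (u : Fin d → ℝ) :
    Tendsto (fun N : ℕ => Real.sqrt N • glsPt N u) atTop (nhds u) := by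
  rw [tendsto_pi_nhds]
  intro i
  rw [tendsto_iff_dist_tendsto_zero]
  have h0 : Tendsto (fun N : ℕ => (Real.sqrt N)⁻¹) atTop (nhds 0) :=
    tendsto_inv_atTop_zero.comp (Real.tendsto_sqrt_atTop.comp tendsto_natCast_atTop_atTop)
  refine squeeze_zero' (Eventually.of_forall fun _ => dist_nonneg) ?_ h0
  filter_upwards [eventually_gt_atTop 0] with N hN
  rw [Real.dist_eq]
  exact gls_floor_close hN (u i)

lemma gls_quad_smul {d : ℕ} (K : Matrix (Fin d) (Fin d) ℝ) (N : ℕ) (x : Fin d → ℝ) :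
    -(N : ℝ) / 2 * (x ⬝ᵥ (K *ᵥ x)) =
      -(1/2) * ((Real.sqrt N • x) ⬝ᵥ (K *ᵥ (Real.sqrt N • x))) := by
  rw [mulVec_smul, dotProduct_smul, smul_dotProduct, smul_eq_mul, smul_eq_mul, ← mul_assoc (Real.sqrt N),
    Real.mul_self_sqrt (Nat.cast_nonneg N)]
  ring

/-- Gaussian lattice-sum asymptotics (underlying the paper's Lemma 3.3): for a
positive definite `K` and sets `A_N` of rescaled lattice points sandwiched
between balls of radii `a ε_N` and `b ε_N`,
`√(det K) (2πN)^{-d/2} ∑_{x ∈ A_N} e^{-(N/2) xᵀKx} → 1`. -/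
theorem gaussian_lattice_sum_asymptotics {d : ℕ}
    (K : Matrix (Fin d) (Fin d) ℝ) (hK : K.PosDef)
    (ε : ℕ → ℝ) (hε : ∀ N, 0 < ε N)
    (h1 : Tendsto (fun N : ℕ => (N : ℝ) * ε N ^ 2) atTop atTop)
    (h2 : Tendsto (fun N : ℕ => (N : ℝ) * ε N ^ 3) atTop (nhds 0))
    (a b : ℝ) (ha : 0 < a) (hab : a ≤ b)
    (A : ℕ → Finset (Fin d → ℝ))
    (hlower : ∀ N : ℕ, ∀ x : Fin d → ℝ, (∀ i, ∃ k : ℤ, x i = k / N) →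
      Real.sqrt (∑ i, x i ^ 2) ≤ a * ε N → x ∈ A N)
    (hupper : ∀ N : ℕ, ∀ x ∈ A N, (∀ i, ∃ k : ℤ, x i = k / N) ∧
      Real.sqrt (∑ i, x i ^ 2) ≤ b * ε N) :
    Tendsto (fun N : ℕ => Real.sqrt K.det * (2 * Real.pi * N) ^ (-(d : ℝ) / 2) *
        ∑ x ∈ A N, Real.exp (-(N : ℝ) / 2 * (x ⬝ᵥ (K *ᵥ x))))
      atTop (nhds 1) := by
  classical
  obtain ⟨c, hc, hcoer⟩ := gls_coercive K hK
  have hpi : (0 : ℝ) < 2 * Real.pi := by positivity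
  have hdet : 0 < Real.sqrt K.det := Real.sqrt_pos.2 hK.det_pos
  have hlim : Tendsto (fun N : ℕ => ∫ u, glsF K (A N) N u) atTop
      (nhds (∫ u : Fin d → ℝ, Real.exp (-(1/2) * (u ⬝ᵥ (K *ᵥ u))))) := by
    refine tendsto_integral_filter_of_dominated_convergence
      (fun u : Fin d → ℝ => ∏ i, (Real.exp (c / 2) * Real.exp (-(c / 4) * u i ^ 2))) ?_ ?_ ?_ ?_
    · refine Eventually.of_forall fun N => Measurable.aestronglyMeasurable ?_
      unfold glsF
      exact Finset.measurable_sum _ fun x _ => measurable_const.indicator (gls_cube_meas N x)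
    · filter_upwards [eventually_gt_atTop 0] with N hN
      refine Eventually.of_forall fun u => ?_
      rw [glsF_eq K (A N) hN (fun x hx => (hupper N x hx).1)]
      have hb : Real.exp (-(N : ℝ) / 2 * (glsPt N u ⬝ᵥ (K *ᵥ glsPt N u))) ≤
          ∏ i, (Real.exp (c / 2) * Real.exp (-(c / 4) * u i ^ 2)) := by
        simp_rw [← Real.exp_add]
        rw [← Real.exp_sum, Real.exp_le_exp, gls_quad_smul]
        have h3 := hcoer (Real.sqrt N • glsPt N u)
        refine (mul_le_mul_of_nonpos_left h3 (by norm_num)).trans ?_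
        rw [Finset.mul_sum, Finset.mul_sum]
        refine Finset.sum_le_sum fun i _ => ?_
        have h4 := gls_floor_close hN (u i)
        have h5 : (Real.sqrt N)⁻¹ ≤ 1 := by
          apply inv_le_one_of_one_le₀
          rw [Real.one_le_sqrt]; exact_mod_cast hN
        have h6 := h4.trans h5
        change -(1/2) * (c * (Real.sqrt N * ((⌊Real.sqrt N * u i⌋ : ℝ) / N)) ^ 2) ≤ _
        set y := Real.sqrt N * ((⌊Real.sqrt N * u i⌋ : ℝ) / N)
        have h7 : (y - u i) ^ 2 ≤ 1 := by rw [sq_le_one_iff_abs_le_one]; exact h6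
        nlinarith [mul_nonneg hc.le (sq_nonneg (2 * y - u i)), mul_le_mul_of_nonneg_left h7 hc.le]
      split_ifs
      · rwa [Real.norm_of_nonneg (Real.exp_pos _).le]
      · rw [norm_zero]; positivity
    · exact Integrable.fintype_prod (f := fun _ t => Real.exp (c / 2) * Real.exp (-(c / 4) * t ^ 2))
        fun _ => (integrable_exp_neg_mul_sq (by positivity)).const_mul _
    · refine Eventually.of_forall fun u => ?_
      have hp := gls_tendsto_pt u
      have hq : Continuous fun y : Fin d → ℝ => Real.exp (-(1/2) * (y ⬝ᵥ (K *ᵥ y))) := by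
        fun_prop
      have hr : Continuous fun y : Fin d → ℝ => Real.sqrt (∑ i, y i ^ 2) := by fun_prop
      refine ((hq.tendsto u).comp hp).congr' ?_
      have hbig : Tendsto (fun N : ℕ => a * Real.sqrt (N * ε N ^ 2)) atTop atTop :=
        (Real.tendsto_sqrt_atTop.comp h1).const_mul_atTop ha
      filter_upwards [eventually_gt_atTop 0, hbig.eventually_ge_atTop (Real.sqrt (∑ i, u i ^ 2) + 1),
        ((hr.tendsto u).comp hp).eventually_le_const (lt_add_one _)] with N hN hN1 hN2
      have hs : 0 < Real.sqrt N := Real.sqrt_pos.2 (by exact_mod_cast hN)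
      have hmem : glsPt N u ∈ A N := by
        refine hlower N _ (fun i => ⟨_, rfl⟩) ?_
        have h8 := hN2.trans hN1
        have e1 : Real.sqrt (∑ i, (Real.sqrt N • glsPt N u) i ^ 2)
            = Real.sqrt N * Real.sqrt (∑ i, glsPt N u i ^ 2) := by
          simp_rw [Pi.smul_apply, smul_eq_mul, mul_pow]
          rw [← Finset.mul_sum, Real.sqrt_mul (by positivity), Real.sqrt_sq hs.le]
        rw [Function.comp_apply, e1, Real.sqrt_mul (by positivity), Real.sqrt_sq (hε N).le] at h8
        refine le_of_mul_le_mul_left ?_ hs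
        linarith
      rw [glsF_eq K (A N) hN (fun x hx => (hupper N x hx).1), if_pos hmem, gls_quad_smul]
      rfl
  rw [gls_integral K hK] at hlim
  have hfin := hlim.const_mul (Real.sqrt K.det * (2 * Real.pi) ^ (-(d : ℝ) / 2))
  have hone : Real.sqrt K.det * (2 * Real.pi) ^ (-(d : ℝ) / 2) *
      ((2 * Real.pi) ^ ((d : ℝ) / 2) / Real.sqrt K.det) = 1 := by
    rw [neg_div, Real.rpow_neg hpi.le]
    have := (Real.rpow_pos_of_pos hpi ((d : ℝ) / 2)).ne'
    field_simp
  rw [hone] at hfin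
  refine hfin.congr fun N => ?_
  rw [glsF_integral, Real.mul_rpow hpi.le (Nat.cast_nonneg N)]
  have : (N : ℝ) ^ (-(d : ℝ) / 2) = (Real.sqrt N)⁻¹ ^ d := by
    rw [neg_div, Real.rpow_neg (Nat.cast_nonneg N), inv_pow, Real.sqrt_eq_rpow,
      ← Real.rpow_mul_natCast (Nat.cast_nonneg N)]
    congr 2; ring
  rw [this]
  ring
end

section
/- Let H be a real symmetric d×d matrix with orthonormal eigenvectors u₁, …, u_d and eigenvalues −λ₁, λ₂, …, λ_d, where λ₁, …, λ_d > 0. Let α > 0 and v ∈ ℝᵈ with coordinates v_k = v·u_k satisfying v₁ > 0 and v₁²/λ₁ = ∑_{k=2}^d v_k²/λ_k + 1/α (equivalently vᵀH⁻¹v = −1/α). Let (ε_N)_{N≥1} be positive reals with N ε_N² → ∞ and N ε_N³ → 0. For t ∈ ℝ and w ∈ ℝᵈ set P_t(w) = {x ∈ ℝᵈ : t ≤ x·u₁ < t + w·u₁} if w·u₁ ≥ 0 and P_t(w) = {x ∈ ℝᵈ : t + w·u₁ < x·u₁ ≤ t} if w·u₁ < 0; for a > 0 set 𝒜_N(a)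 = {x ∈ (N⁻¹ℤ)ᵈ : ∑_{j=2}^d λ_j (x·u_j)² ≤ (1+a) λ₁ ε_N²}. Then for every z ∈ ℤᵈ, every a > 0, every r > 0 and every real sequence (t_N) with |t_N| ≤ ε_N + r/N, the quantity (2πN)^{−(d−1)/2} ∑_{x ∈ P_{t_N}(N⁻¹z) ∩ 𝒜_N(a)} exp(−(N/2) xᵀ(H + α v vᵀ)x) converges, as N → ∞, to (|u₁·z| / (u₁·v)) · √(λ₁ / (α ∏_{k=2}^d λ_k)). -/
open Matrix Filter MeasureTheory

noncomputable def kap {d : ℕ} (ℓ : Fin d → ℝ) (z : Fin d → ℤ) (s c : ℝ) (y : Fin d → ℝ) : Fin d → ℤ :=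
  fun i => ⌊y i⌋ - ⌊(ℓ ⬝ᵥ (fun i => (⌊y i⌋ : ℝ)) - s) / c⌋ * z i

theorem measurable_kap {d : ℕ} (ℓ : Fin d → ℝ) (z : Fin d → ℤ) (s c : ℝ) :
    Measurable (kap ℓ z s c) := by
  have h : Measurable (fun y : Fin d → ℝ => ⌊(ℓ ⬝ᵥ (fun i => (⌊y i⌋ : ℝ)) - s) / c⌋) := by
    apply Int.measurable_floor.comp
    apply Measurable.div_const
    apply Measurable.sub_const
    unfold dotProduct
    apply Finset.measurable_sum
    intro i _
    apply Measurable.const_mul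
    exact (measurable_from_top (f := fun n : ℤ => (n : ℝ))).comp
      (Int.measurable_floor.comp (measurable_pi_apply i))
  rw [measurable_pi_iff]
  intro i
  unfold kap
  exact (Int.measurable_floor.comp (measurable_pi_apply i)).sub (h.mul_const _)

def slab {d : ℕ} (ℓ : Fin d → ℝ) (s c : ℝ) : Set (Fin d → ℝ) :=
  {y | s ≤ ℓ ⬝ᵥ y ∧ ℓ ⬝ᵥ y < s + c}

def zslab {d : ℕ} (ℓ : Fin d → ℝ) (s c : ℝ) : Set (Fin d → ℤ) :=
  {k | s ≤ ℓ ⬝ᵥ (fun i => (k i : ℝ)) ∧ ℓ ⬝ᵥ (fun i => (k i : ℝ)) < s + c}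

theorem measurable_dot {d : ℕ} (ℓ : Fin d → ℝ) : Measurable (fun y : Fin d → ℝ => ℓ ⬝ᵥ y) := by
  unfold dotProduct
  fun_prop

theorem measurableSet_slab {d : ℕ} (ℓ : Fin d → ℝ) (s c : ℝ) : MeasurableSet (slab ℓ s c) :=
  (measurableSet_le measurable_const (measurable_dot ℓ)).inter
    (measurableSet_lt (measurable_dot ℓ) measurable_const)

def box {d : ℕ} (k : Fin d → ℤ) : Set (Fin d → ℝ) := {y | ∀ i, ⌊y i⌋ = k i}

theorem box_eq {d : ℕ} (k : Fin d → ℤ) :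
    box k = Set.pi Set.univ (fun i => Set.Ico (k i : ℝ) (k i + 1)) := by
  ext y
  simp [box, Int.floor_eq_iff]

theorem volume_box {d : ℕ} (k : Fin d → ℤ) : volume (box k) = 1 := by
  rw [box_eq, volume_pi_pi]; simp

theorem measurableSet_box {d : ℕ} (k : Fin d → ℤ) : MeasurableSet (box k) := by
  rw [box_eq]; exact MeasurableSet.univ_pi fun i => measurableSet_Ico

theorem dot_floor_kap {d : ℕ} (ℓ : Fin d → ℝ) (z : Fin d → ℤ) (s c : ℝ)
    (hz : ℓ ⬝ᵥ (fun i => (z i : ℝ)) = c) (y : Fin d → ℝ) :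
    ℓ ⬝ᵥ (fun i => (kap ℓ z s c y i : ℝ)) = ℓ ⬝ᵥ (fun i => (⌊y i⌋ : ℝ)) -
      ⌊(ℓ ⬝ᵥ (fun i => (⌊y i⌋ : ℝ)) - s) / c⌋ * c := by
  have : (fun i => (kap ℓ z s c y i : ℝ)) = (fun i => (⌊y i⌋ : ℝ)) -
      (⌊(ℓ ⬝ᵥ (fun i => (⌊y i⌋ : ℝ)) - s) / c⌋ : ℝ) • (fun i => (z i : ℝ)) := by
    ext i; simp [kap]
  rw [this, dotProduct_sub, dotProduct_smul, hz, smul_eq_mul]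

theorem kap_mem {d : ℕ} (ℓ : Fin d → ℝ) (z : Fin d → ℤ) (s c : ℝ) (hc : 0 < c)
    (hz : ℓ ⬝ᵥ (fun i => (z i : ℝ)) = c) (y : Fin d → ℝ) : kap ℓ z s c y ∈ zslab ℓ s c := by
  simp only [zslab, Set.mem_ofPred_eq]
  rw [dot_floor_kap ℓ z s c hz]
  set p := ℓ ⬝ᵥ (fun i => (⌊y i⌋ : ℝ))
  have h1 := Int.floor_le ((p - s) / c)
  have h2 := Int.lt_floor_add_one ((p - s) / c)
  rw [le_div_iff₀ hc] at h1
  rw [div_lt_iff₀ hc] at h2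
  constructor <;> linarith

theorem kap_preimage {d : ℕ} (ℓ : Fin d → ℝ) (z : Fin d → ℤ) (s c : ℝ) (hc : 0 < c)
    (hz : ℓ ⬝ᵥ (fun i => (z i : ℝ)) = c) (k : Fin d → ℤ) (hk : k ∈ zslab ℓ s c) :
    kap ℓ z s c ⁻¹' {k} = ⋃ n : ℤ, box (k + n • z) := by
  ext y
  simp only [Set.mem_preimage, Set.mem_singleton_iff, Set.mem_iUnion, box, Set.mem_ofPred_eq]
  constructor
  · rintro rfl
    refine ⟨⌊(ℓ ⬝ᵥ (fun i => (⌊y i⌋ : ℝ)) - s) / c⌋, fun i => ?_⟩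
    simp only [kap, Pi.add_apply, Pi.smul_apply, smul_eq_mul]
    exact (sub_add_cancel _ _).symm
  · rintro ⟨n, hn⟩
    have h1 : (fun i => (⌊y i⌋ : ℝ)) = (fun i => (k i : ℝ)) + (n : ℝ) • (fun i => (z i : ℝ)) := by
      ext i; simp [hn]
    have h2 : ⌊(ℓ ⬝ᵥ (fun i => (⌊y i⌋ : ℝ)) - s) / c⌋ = n := by
      rw [h1, dotProduct_add, dotProduct_smul, hz, smul_eq_mul, Int.floor_eq_iff,
        le_div_iff₀ hc, div_lt_iff₀ hc]
      obtain ⟨h3, h4⟩ := hk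
      constructor <;> linarith
    ext i
    simp only [kap, h2, hn i]
    simp

theorem volume_kap {d : ℕ} (ℓ : Fin d → ℝ) (z : Fin d → ℤ) (s c : ℝ) (hc : 0 < c)
    (hz : ℓ ⬝ᵥ (fun i => (z i : ℝ)) = c) (k : Fin d → ℤ) (hk : k ∈ zslab ℓ s c) :
    volume (kap ℓ z s c ⁻¹' {k} ∩ slab ℓ s c) = 1 := by
  have hms := measurableSet_slab ℓ s c
  have hz0 : z ≠ 0 := by
    rintro rfl
    simp [dotProduct] at hz; linarith
  have hzi : ∀ n : ℤ, n • z = 0 → n = 0 := by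
    intro n hn
    exact (smul_eq_zero.mp hn).resolve_right hz0
  rw [kap_preimage ℓ z s c hc hz k hk, Set.iUnion_inter, measure_iUnion]
  rotate_left
  · intro n n' hnn
    rw [Function.onFun, Set.disjoint_left]
    rintro y ⟨h1, _⟩ ⟨h2, _⟩
    apply hnn
    have : (n - n') • z = 0 := by
      ext i
      have := h1 i
      have := h2 i
      simp [sub_mul] at *
      linarith
    have := hzi _ this
    linarith
  · intro n; exact (measurableSet_box _).inter hms
  let zz : Fin d → ℝ := fun i => (z i : ℝ)
  have key : ∀ n : ℤ, volume (box (k + n • z) ∩ slab ℓ s c) =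
      volume (box k ∩ (fun y => (y + (n : ℝ) • zz)) ⁻¹' slab ℓ s c) := by
    intro n
    rw [← measure_preimage_add_right volume ((n : ℝ) • zz) (box (k + n • z) ∩ slab ℓ s c)]
    congr 1
    ext y
    simp only [box, Set.mem_preimage, Set.mem_inter_iff, Set.mem_ofPred_eq]
    refine and_congr (forall_congr' fun i => ?_) Iff.rfl
    simp only [Pi.add_apply, Pi.smul_apply, smul_eq_mul, zz]
    rw [← Int.cast_mul, Int.floor_add_intCast, add_left_inj]
  simp_rw [key]
  have hmem : ∀ (n : ℤ) (y : Fin d → ℝ), y + (n : ℝ) • zz ∈ slab ℓ s c ↔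
      -n = ⌊(ℓ ⬝ᵥ y - s) / c⌋ := by
    intro n y
    rw [eq_comm, Int.floor_eq_iff, le_div_iff₀ hc, div_lt_iff₀ hc]
    simp only [slab, Set.mem_ofPred_eq, dotProduct_add, dotProduct_smul, smul_eq_mul, zz, hz]
    push_cast
    constructor <;> rintro ⟨h1, h2⟩ <;> constructor <;> linarith
  rw [← measure_iUnion]
  · rw [← Set.inter_iUnion, ← volume_box k]
    congr 1
    apply Set.inter_eq_left.mpr
    intro y _
    rw [Set.mem_iUnion]
    exact ⟨-⌊(ℓ ⬝ᵥ y - s) / c⌋, (hmem _ _).mpr (neg_neg _)⟩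
  · intro n n' hnn
    rw [Function.onFun, Set.disjoint_left]
    rintro y ⟨_, h1⟩ ⟨_, h2⟩
    have h1 := (hmem _ _).mp h1
    have h2 := (hmem _ _).mp h2
    apply hnn; linarith
  · intro n
    exact (measurableSet_box _).inter (hms.preimage (measurable_id.add_const _))

theorem unfold_slab {d : ℕ} (ℓ : Fin d → ℝ) (z : Fin d → ℤ) (s c : ℝ) (hc : 0 < c)
    (hz : ℓ ⬝ᵥ (fun i => (z i : ℝ)) = c) (F : (Fin d → ℤ) → ℝ)
    (hF : IntegrableOn (fun y => F (kap ℓ z s c y)) (slab ℓ s c)) :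
    ∫ y in slab ℓ s c, F (kap ℓ z s c y) = ∑' k : zslab ℓ s c, F k := by
  have hm := measurable_kap ℓ z s c
  have hFm : Measurable F := measurable_of_countable F
  have h1 : ∫ y in slab ℓ s c, F (kap ℓ z s c y) =
      ∫ k, F k ∂((volume.restrict (slab ℓ s c)).map (kap ℓ z s c)) := by
    rw [integral_map hm.aemeasurable hFm.aestronglyMeasurable]
  have hint : Integrable F ((volume.restrict (slab ℓ s c)).map (kap ℓ z s c)) := by
    rw [integrable_map_measure hFm.aestronglyMeasurable hm.aemeasurable]
    exact hF
  rw [h1, integral_countable' hint, tsum_subtype (zslab ℓ s c) F]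
  congr 1
  ext k
  rw [measureReal_def, Measure.map_apply hm (measurableSet_singleton k),
    Measure.restrict_apply (hm (measurableSet_singleton k))]
  by_cases hk : k ∈ zslab ℓ s c
  · rw [volume_kap ℓ z s c hc hz k hk]; simp [hk]
  · have : kap ℓ z s c ⁻¹' {k} = ∅ := by
      ext y
      simp only [Set.mem_preimage, Set.mem_singleton_iff, Set.mem_empty_iff_false, iff_false]
      rintro rfl
      exact hk (kap_mem ℓ z s c hc hz y)
    simp [this, hk]

theorem kap_close {d : ℕ} (ℓ : Fin d → ℝ) (z : Fin d → ℤ) (c : ℝ) (hc : 0 < c) :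
    ∃ K : ℝ, ∀ s y, y ∈ slab ℓ s c → ∀ i, |(kap ℓ z s c y i : ℝ) - y i| ≤ K := by
  refine ⟨1 + ((c + ∑ i, |ℓ i|) / c + 1) * ∑ i, |(z i : ℝ)|, ?_⟩
  rintro s y ⟨hy1, hy2⟩ i
  set L := ∑ i, |ℓ i| with hL
  have hL0 : 0 ≤ L := Finset.sum_nonneg fun i _ => abs_nonneg _
  set n := ⌊(ℓ ⬝ᵥ (fun i => (⌊y i⌋ : ℝ)) - s) / c⌋ with hn
  have hdiff : |ℓ ⬝ᵥ (fun i => (⌊y i⌋ : ℝ)) - ℓ ⬝ᵥ y| ≤ L := by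
    rw [← dotProduct_sub]
    unfold dotProduct
    refine (Finset.abs_sum_le_sum_abs _ _).trans (Finset.sum_le_sum fun i _ => ?_)
    rw [abs_mul]
    apply mul_le_of_le_one_right (abs_nonneg _)
    simp only [Pi.sub_apply]
    rw [abs_le]
    constructor <;> linarith [Int.floor_le (y i), Int.lt_floor_add_one (y i)]
  have hnb : |(n : ℝ)| ≤ (c + L) / c + 1 := by
    have h1 := Int.floor_le ((ℓ ⬝ᵥ (fun i => (⌊y i⌋ : ℝ)) - s) / c)
    have h2 := Int.lt_floor_add_one ((ℓ ⬝ᵥ (fun i => (⌊y i⌋ : ℝ)) - s) / c)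
    rw [← hn] at h1 h2
    rw [abs_le] at hdiff ⊢
    have h3 : (ℓ ⬝ᵥ (fun i => (⌊y i⌋ : ℝ)) - s) / c ≤ (c + L) / c :=
      div_le_div_of_nonneg_right (by linarith) hc.le
    have h4 : -((c + L) / c) ≤ (ℓ ⬝ᵥ (fun i => (⌊y i⌋ : ℝ)) - s) / c := by
      rw [← neg_div]
      exact div_le_div_of_nonneg_right (by linarith) hc.le
    constructor <;> linarith
  have hzi : |(z i : ℝ)| ≤ ∑ i, |(z i : ℝ)| :=
    Finset.single_le_sum (f := fun i => |(z i : ℝ)|) (fun i _ => abs_nonneg _) (Finset.mem_univ i)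
  have heq : (kap ℓ z s c y i : ℝ) - y i = ((⌊y i⌋ : ℝ) - y i) - n * z i := by
    simp only [kap, ← hn]; push_cast; ring
  rw [heq]
  refine (abs_sub _ _).trans (add_le_add ?_ ?_)
  · rw [abs_le]
    constructor <;> linarith [Int.floor_le (y i), Int.lt_floor_add_one (y i)]
  · rw [abs_mul]
    exact mul_le_mul hnb hzi (abs_nonneg _) (by positivity)

theorem mulVec_close {d : ℕ} (A : Matrix (Fin d) (Fin d) ℝ) (K : ℝ) :
    ∃ K' : ℝ, 0 ≤ K' ∧ ∀ x y : Fin d → ℝ, (∀ i, |x i - y i| ≤ K) →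
      ∀ j, |(A *ᵥ x) j - (A *ᵥ y) j| ≤ K' := by
  refine ⟨∑ j, ∑ i, |A j i| * |K|, by positivity, fun x y h j => ?_⟩
  have h1 : (A *ᵥ x) j - (A *ᵥ y) j = ∑ i, A j i * (x i - y i) := by
    simp [mulVec, dotProduct, mul_sub]
  rw [h1]
  refine (Finset.abs_sum_le_sum_abs _ _).trans ?_
  refine le_trans (Finset.sum_le_sum fun i _ => ?_)
    (Finset.single_le_sum (f := fun j => ∑ i, |A j i| * |K|)
      (fun i _ => by positivity) (Finset.mem_univ j))
  rw [abs_mul]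
  exact mul_le_mul_of_nonneg_left ((h i).trans (le_abs_self _)) (abs_nonneg _)

theorem measurable_affine {d : ℕ} (M : Matrix (Fin d) (Fin d) ℝ) (b : Fin d → ℝ) :
    Measurable (fun ξ : Fin d → ℝ => M *ᵥ ξ + b) := by
  apply Measurable.add_const
  rw [measurable_pi_iff]
  intro i
  exact measurable_dot (M i)

theorem map_affine {d : ℕ} (M : Matrix (Fin d) (Fin d) ℝ) (hM : M.det ≠ 0) (b : Fin d → ℝ) :
    Measure.map (fun ξ : Fin d → ℝ => M *ᵥ ξ + b) volume =
      ENNReal.ofReal (|M.det|⁻¹) • volume := by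
  have h0 : (fun ξ : Fin d → ℝ => M *ᵥ ξ + b) = (fun y => y + b) ∘ (toLin' M) := by
    ext; simp
  have hm : Measurable (toLin' M) := (LinearMap.continuous_of_finiteDimensional _).measurable
  rw [h0, ← Measure.map_map (measurable_add_const b) hm,
    Real.map_matrix_volume_pi_eq_smul_volume_pi hM, Measure.map_smul, map_add_right_eq_self, abs_inv]

theorem cov_affine {d : ℕ} (M : Matrix (Fin d) (Fin d) ℝ) (hM : M.det ≠ 0) (b : Fin d → ℝ)
    (f : (Fin d → ℝ) → ℝ) (hf : Measurable f)
    (hi : Integrable (fun ξ => f (M *ᵥ ξ + b))) :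
    Integrable f ∧ ∫ y, f y = |M.det| * ∫ ξ, f (M *ᵥ ξ + b) := by
  have hp : 0 < |M.det| := abs_pos.mpr hM
  have hma := measurable_affine M b
  have h1 := integral_map hma.aemeasurable (μ := volume) hf.aestronglyMeasurable
  have h2 := integrable_map_measure (μ := volume) hf.aestronglyMeasurable hma.aemeasurable
  rw [map_affine M hM b] at h1 h2
  constructor
  · rw [← integrable_smul_measure (c := ENNReal.ofReal (|M.det|⁻¹)) _ ENNReal.ofReal_ne_top]
    · exact h2.mpr hi
    · simp only [ne_eq, ENNReal.ofReal_eq_zero, not_le]; positivity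
  · rw [← h1, integral_smul_measure, ENNReal.toReal_ofReal (by positivity), smul_eq_mul,
      mul_inv_cancel_left₀ hp.ne']

noncomputable def gfun {d : ℕ} [NeZero d] (b c : ℝ) (j : Fin d) (x : ℝ) : ℝ :=
  if j = 0 then (Set.Ico 0 c).indicator (fun _ => 1) x else Real.exp (-b * x ^ 2)

theorem gfun_prod {d : ℕ} [NeZero d] (b c : ℝ) (ξ : Fin d → ℝ) :
    ∏ j, gfun b c j (ξ j) = (Set.Ico 0 c).indicator (fun _ => 1) (ξ 0) *
      Real.exp (-b * ∑ j ∈ Finset.univ.erase 0, ξ j ^ 2) := by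
  rw [← Finset.mul_prod_erase _ _ (Finset.mem_univ 0), Finset.mul_sum, Real.exp_sum]
  have h0 : gfun (d := d) b c 0 (ξ 0) = (Set.Ico 0 c).indicator (fun _ => 1) (ξ 0) := by simp [gfun]
  rw [h0]
  congr 1
  refine Finset.prod_congr rfl fun j hj => ?_
  simp [gfun, Finset.ne_of_mem_erase hj]

theorem gfun_integrable {d : ℕ} [NeZero d] (b c : ℝ) (hb : 0 < b) :
    Integrable (fun ξ : Fin d → ℝ => ∏ j, gfun b c j (ξ j)) := by
  apply Integrable.fintype_prod
  intro j
  by_cases hj : j = 0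
  · have : gfun (d := d) b c j = (Set.Ico 0 c).indicator (fun _ => 1) := by
      ext x; simp [gfun, hj]
    rw [this]
    exact (integrable_indicator_iff measurableSet_Ico).mpr (by simp)
  · have : gfun (d := d) b c j = fun x => Real.exp (-b * x ^ 2) := by
      ext x; simp [gfun, hj]
    rw [this]
    exact integrable_exp_neg_mul_sq hb

theorem gfun_integral {d : ℕ} [NeZero d] (c : ℝ) (hc : 0 < c) :
    ∫ ξ : Fin d → ℝ, ∏ j, gfun (1 / 2) c j (ξ j) = c * (Real.sqrt (2 * Real.pi)) ^ (d - 1) := by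
  rw [integral_fintype_prod_volume_eq_prod, ← Finset.mul_prod_erase _ _ (Finset.mem_univ 0)]
  congr 1
  · have : gfun (d := d) (1 / 2) c 0 = (Set.Ico 0 c).indicator (fun _ => 1) := by
      ext x; simp [gfun]
    rw [this, integral_indicator measurableSet_Ico]
    simp [hc.le]
  · rw [Finset.prod_congr rfl (g := fun _ => Real.sqrt (2 * Real.pi))]
    · simp
    · intro j hj
      have : gfun (d := d) (1 / 2) c j = fun x => Real.exp (-(1 / 2) * x ^ 2) := by
        ext x; simp [gfun, Finset.ne_of_mem_erase hj]
      rw [this, integral_gaussian]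
      congr 1; ring

theorem abstract_limit {d : ℕ} [NeZero d] (A : Matrix (Fin d) (Fin d) ℝ) (hA : A.det ≠ 0)
    (z : Fin d → ℤ) (c : ℝ) (hc : 0 < c) (hz : A 0 ⬝ᵥ (fun i => (z i : ℝ)) = c)
    (s : ℕ → ℝ) (C : ℕ → Set (Fin d → ℤ))
    (hC : ∀ K : ℝ, ∀ᶠ N : ℕ in atTop, ∀ k ∈ zslab (A 0) (s N) c,
      (∀ j, j ≠ 0 → |(A *ᵥ (fun i => (k i : ℝ))) j| ≤ K * Real.sqrt N) → k ∈ C N) :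
    Tendsto (fun N : ℕ => (2 * Real.pi * N) ^ (-((d : ℝ) - 1) / 2) *
      ∑' k : zslab (A 0) (s N) c, (C N).indicator (fun k => Real.exp (-(N : ℝ)⁻¹ / 2 *
        ∑ j ∈ Finset.univ.erase 0, (A *ᵥ (fun i => (k i : ℝ))) j ^ 2)) (k : Fin d → ℤ))
      atTop (nhds (c / |A.det|)) := by
  obtain ⟨K₀, hK₀⟩ := kap_close (A 0) z c hc
  obtain ⟨K, hK0, hK⟩ := mulVec_close A K₀
  have hdA : IsUnit A.det := isUnit_iff_ne_zero.mpr hA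
  let F : ℕ → (Fin d → ℤ) → ℝ := fun N => (C N).indicator (fun k => Real.exp (-(N : ℝ)⁻¹ / 2 *
        ∑ j ∈ Finset.univ.erase 0, (A *ᵥ (fun i => (k i : ℝ))) j ^ 2))
  let dd : ℕ → Fin d → ℝ := fun N j => if j = 0 then 1 else Real.sqrt N
  let M : ℕ → Matrix (Fin d) (Fin d) ℝ := fun N => A⁻¹ * diagonal (dd N)
  let b : ℕ → Fin d → ℝ := fun N => A⁻¹ *ᵥ (Pi.single 0 (s N))
  let f : ℕ → (Fin d → ℝ) → ℝ := fun N =>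
    (slab (A 0) (s N) c).indicator (fun y => F N (kap (A 0) z (s N) c y))
  have hfm : ∀ N, Measurable (f N) := fun N =>
    ((measurable_of_countable (F N)).comp (measurable_kap _ _ _ _)).indicator
      (measurableSet_slab _ _ _)
  have hAM : ∀ N ξ, A *ᵥ (M N *ᵥ ξ + b N) = fun j => dd N j * ξ j + (Pi.single 0 (s N) : Fin d → ℝ) j := by
    intro N ξ
    simp only [M, b, mulVec_add, mulVec_mulVec, ← Matrix.mul_assoc, mul_nonsing_inv A hdA,
      Matrix.one_mul, one_mulVec]
    ext j
    simp [mulVec_diagonal]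
  have hA0 : ∀ N ξ, A 0 ⬝ᵥ (M N *ᵥ ξ + b N) = ξ 0 + s N := by
    intro N ξ
    have := congrFun (hAM N ξ) 0
    simpa [dd, mulVec] using this
  have hAj : ∀ N ξ j, j ≠ 0 → (A *ᵥ (M N *ᵥ ξ + b N)) j = Real.sqrt N * ξ j := by
    intro N ξ j hj
    rw [hAM]; simp [dd, hj]
  have hslab : ∀ N ξ, (M N *ᵥ ξ + b N) ∈ slab (A 0) (s N) c ↔ ξ 0 ∈ Set.Ico 0 c := by
    intro N ξ
    simp only [slab, Set.mem_ofPred_eq, hA0, Set.mem_Ico]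
    constructor <;> rintro ⟨h1, h2⟩ <;> constructor <;> linarith
  have hclose : ∀ N ξ, ξ 0 ∈ Set.Ico 0 c → ∀ j, j ≠ 0 →
      |(A *ᵥ (fun i => (kap (A 0) z (s N) c (M N *ᵥ ξ + b N) i : ℝ))) j - Real.sqrt N * ξ j| ≤ K := by
    intro N ξ hξ j hj
    rw [← hAj N ξ j hj]
    exact hK _ _ (hK₀ _ _ ((hslab N ξ).mpr hξ)) j
  -- the exponent
  have hexp : ∀ N : ℕ, 0 < N → ∀ k : Fin d → ℤ, -(N : ℝ)⁻¹ / 2 *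
        ∑ j ∈ Finset.univ.erase 0, (A *ᵥ (fun i => (k i : ℝ))) j ^ 2 =
      -(1 / 2) * ∑ j ∈ Finset.univ.erase 0, ((A *ᵥ (fun i => (k i : ℝ))) j / Real.sqrt N) ^ 2 := by
    intro N hN k
    simp only [div_pow, Real.sq_sqrt (Nat.cast_nonneg N), ← Finset.sum_div]
    ring
  have hratio : ∀ N : ℕ, 0 < N → ∀ ξ, ξ 0 ∈ Set.Ico 0 c → ∀ j, j ≠ 0 →
      |(A *ᵥ (fun i => (kap (A 0) z (s N) c (M N *ᵥ ξ + b N) i : ℝ))) j / Real.sqrt N - ξ j|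
        ≤ K / Real.sqrt N := by
    intro N hN ξ hξ j hj
    have hs : 0 < Real.sqrt N := Real.sqrt_pos.mpr (by exact_mod_cast hN)
    rw [div_sub' hs.ne', abs_div, abs_of_pos hs]
    exact div_le_div_of_nonneg_right (hclose N ξ hξ j hj) hs.le
  have hbound : ∀ N : ℕ, 0 < N → ∀ ξ, ‖f N (M N *ᵥ ξ + b N)‖ ≤
      Real.exp (d * K ^ 2) * ∏ j, gfun (1 / 4) c j (ξ j) := by
    intro N hN ξ
    rw [gfun_prod]
    by_cases hξ : ξ 0 ∈ Set.Ico 0 c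
    · simp only [f, Set.indicator_of_mem ((hslab N ξ).mpr hξ), Set.indicator_of_mem hξ, one_mul]
      refine (norm_indicator_le_norm_self _ _).trans ?_
      rw [Real.norm_of_nonneg (Real.exp_pos _).le, ← Real.exp_add, Real.exp_le_exp, hexp N hN]
      have hterm : ∀ j ∈ Finset.univ.erase (0 : Fin d), (1 / 2) * ξ j ^ 2 - K ^ 2 ≤
          ((A *ᵥ (fun i => (kap (A 0) z (s N) c (M N *ᵥ ξ + b N) i : ℝ))) j / Real.sqrt N) ^ 2 := by
        intro j hj
        have h1 := hratio N hN ξ hξ j (Finset.ne_of_mem_erase hj)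
        set p := (A *ᵥ (fun i => (kap (A 0) z (s N) c (M N *ᵥ ξ + b N) i : ℝ))) j / Real.sqrt N
        have h2 : K / Real.sqrt N ≤ K := by
          apply div_le_self hK0
          rw [Real.one_le_sqrt]; exact_mod_cast hN
        have h3 : (p - ξ j) ^ 2 ≤ K ^ 2 := sq_le_sq' (by linarith [(abs_le.mp h1).1]) (by linarith [(abs_le.mp h1).2])
        nlinarith [sq_nonneg (2 * p - ξ j)]
      have hsum := Finset.sum_le_sum hterm
      rw [Finset.sum_sub_distrib, ← Finset.mul_sum] at hsum
      have hcard : ∑ j ∈ Finset.univ.erase (0 : Fin d), K ^ 2 ≤ d * K ^ 2 := by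
        rw [Finset.sum_const, nsmul_eq_mul]
        apply mul_le_mul_of_nonneg_right _ (sq_nonneg K)
        have := Finset.card_erase_le (s := (Finset.univ : Finset (Fin d))) (a := 0)
        simp only [Finset.card_univ, Fintype.card_fin] at this
        exact_mod_cast this
      have : 0 ≤ d * K ^ 2 := by positivity
      linarith
    · simp [f, Set.indicator_of_notMem (fun h => hξ ((hslab N ξ).mp h)), Set.indicator_of_notMem hξ]
  have hboundint : Integrable (fun ξ : Fin d → ℝ => Real.exp (d * K ^ 2) * ∏ j, gfun (1 / 4) c j (ξ j)) :=
    (gfun_integrable (1 / 4) c (by norm_num)).const_mul _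
  have hfcm : ∀ N, Measurable (fun ξ => f N (M N *ᵥ ξ + b N)) := fun N =>
    (hfm N).comp (measurable_affine (M N) (b N))
  have hlim : Tendsto (fun N : ℕ => ∫ ξ, f N (M N *ᵥ ξ + b N)) atTop
      (nhds (∫ ξ : Fin d → ℝ, ∏ j, gfun (1 / 2) c j (ξ j))) := by
    apply tendsto_integral_filter_of_dominated_convergence _ _ _ hboundint
    · refine Eventually.of_forall fun ξ => ?_
      by_cases hξ : ξ 0 ∈ Set.Ico 0 c
      · rw [gfun_prod, Set.indicator_of_mem hξ, one_mul]
        have hsq : Tendsto (fun N : ℕ => K / Real.sqrt N) atTop (nhds 0) :=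
          (Real.tendsto_sqrt_atTop.comp tendsto_natCast_atTop_atTop).const_div_atTop K
        have hj : ∀ j ∈ Finset.univ.erase (0 : Fin d), Tendsto (fun N : ℕ =>
            (A *ᵥ (fun i => (kap (A 0) z (s N) c (M N *ᵥ ξ + b N) i : ℝ))) j / Real.sqrt N)
            atTop (nhds (ξ j)) := by
          intro j hj
          rw [tendsto_iff_norm_sub_tendsto_zero]
          refine squeeze_zero' (Eventually.of_forall fun N => norm_nonneg _) ?_ hsq
          filter_upwards [eventually_gt_atTop 0] with N hN
          exact hratio N hN ξ hξ j (Finset.ne_of_mem_erase hj)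
        have hT : Tendsto (fun N : ℕ => Real.exp (-(1 / 2) * ∑ j ∈ Finset.univ.erase (0 : Fin d),
            ((A *ᵥ (fun i => (kap (A 0) z (s N) c (M N *ᵥ ξ + b N) i : ℝ))) j / Real.sqrt N) ^ 2))
            atTop (nhds (Real.exp (-(1 / 2) * ∑ j ∈ Finset.univ.erase (0 : Fin d), ξ j ^ 2))) := by
          apply (Real.continuous_exp.tendsto _).comp
          exact (tendsto_finsetSum _ fun j h => (hj j h).pow 2).const_mul _
        refine hT.congr' ?_
        filter_upwards [eventually_gt_atTop 0, hC (K + ∑ j, |ξ j|)] with N hN hCN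
        have hmem : kap (A 0) z (s N) c (M N *ᵥ ξ + b N) ∈ C N := by
          apply hCN _ (kap_mem (A 0) z (s N) c hc hz _)
          intro j hj
          have h1 := hclose N ξ hξ j hj
          have hs : 1 ≤ Real.sqrt N := by
            rw [Real.one_le_sqrt]; exact_mod_cast hN
          have h2 : |ξ j| ≤ ∑ j, |ξ j| :=
            Finset.single_le_sum (f := fun i => |ξ i|) (fun i _ => abs_nonneg _) (Finset.mem_univ j)
          have h3 : |Real.sqrt N * ξ j| ≤ Real.sqrt N * ∑ j, |ξ j| := by
            rw [abs_mul, abs_of_nonneg (by positivity)]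
            exact mul_le_mul_of_nonneg_left h2 (by positivity)
          have h4 := abs_sub_abs_le_abs_sub ((A *ᵥ (fun i => (kap (A 0) z (s N) c (M N *ᵥ ξ + b N) i : ℝ))) j) (Real.sqrt N * ξ j)
          nlinarith
        simp only [f, Set.indicator_of_mem ((hslab N ξ).mpr hξ), F, Set.indicator_of_mem hmem]
        rw [hexp N hN]
      · rw [gfun_prod, Set.indicator_of_notMem hξ, zero_mul]
        simp [f, Set.indicator_of_notMem (fun h => hξ ((hslab _ ξ).mp h))]
    · exact Eventually.of_forall fun N => (hfcm N).aestronglyMeasurable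
    · filter_upwards [eventually_gt_atTop 0] with N hN
      exact Eventually.of_forall (hbound N hN)
  rw [gfun_integral c hc] at hlim
  have hfin := hlim.const_mul ((2 * Real.pi) ^ (-((d : ℝ) - 1) / 2) * |A.det|⁻¹)
  have hd1 : ((d - 1 : ℕ) : ℝ) = (d : ℝ) - 1 := by
    rw [Nat.cast_sub (NeZero.one_le)]; simp
  have hsqrtpow : ∀ x : ℝ, 0 < x → Real.sqrt x ^ (d - 1) = x ^ (((d : ℝ) - 1) / 2) := by
    intro x hx
    rw [Real.sqrt_eq_rpow, ← Real.rpow_natCast, ← Real.rpow_mul hx.le, hd1]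
    congr 1; ring
  have hcancel : ∀ x : ℝ, 0 < x → x ^ (-((d : ℝ) - 1) / 2) * Real.sqrt x ^ (d - 1) = 1 := by
    intro x hx
    rw [hsqrtpow x hx, ← Real.rpow_add hx]
    convert Real.rpow_zero x using 2
    ring
  have h2pi : 0 < 2 * Real.pi := by positivity
  have hval : (2 * Real.pi) ^ (-((d : ℝ) - 1) / 2) * |A.det|⁻¹ *
      (c * Real.sqrt (2 * Real.pi) ^ (d - 1)) = c / |A.det| := by
    have := hcancel _ h2pi
    calc _ = ((2 * Real.pi) ^ (-((d : ℝ) - 1) / 2) * Real.sqrt (2 * Real.pi) ^ (d - 1)) *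
        (c * |A.det|⁻¹) := by ring
      _ = _ := by rw [this]; ring
  rw [hval] at hfin
  refine hfin.congr' ?_
  filter_upwards [eventually_gt_atTop 0] with N hN
  have hNp : (0 : ℝ) < N := by exact_mod_cast hN
  have hdetD : (diagonal (dd N)).det = Real.sqrt N ^ (d - 1) := by
    rw [det_diagonal, ← Finset.mul_prod_erase _ _ (Finset.mem_univ 0),
      Finset.prod_congr rfl (g := fun _ => Real.sqrt N)]
    · simp [dd]
    · intro j hj; simp [dd, Finset.ne_of_mem_erase hj]
  have hdetM : (M N).det = A.det⁻¹ * Real.sqrt N ^ (d - 1) := by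
    simp only [M, det_mul, hdetD, det_nonsing_inv, Ring.inverse_eq_inv']
  have hMne : (M N).det ≠ 0 := by
    rw [hdetM]
    have : 0 < Real.sqrt N := Real.sqrt_pos.mpr hNp
    positivity
  have hint : Integrable (fun ξ => f N (M N *ᵥ ξ + b N)) :=
    hboundint.mono' (hfcm N).aestronglyMeasurable (Eventually.of_forall (hbound N hN))
  obtain ⟨hi, hcov⟩ := cov_affine (M N) hMne (b N) (f N) (hfm N) hint
  have hS := unfold_slab (A 0) z (s N) c hc hz (F N)
    ((integrable_indicator_iff (measurableSet_slab _ _ _)).mp hi)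
  rw [← integral_indicator (measurableSet_slab _ _ _)] at hS
  change ∫ y, f N y = _ at hS
  change _ = _ * ∑' k : zslab (A 0) (s N) c, F N k
  rw [← hS, hcov, hdetM, abs_mul, abs_inv, abs_of_nonneg (by positivity : 0 ≤ Real.sqrt N ^ (d - 1)),
    Real.mul_rpow h2pi.le hNp.le]
  have := hcancel _ hNp
  generalize (∫ ξ, f N (M N *ᵥ ξ + b N)) = I
  calc _ = (2 * Real.pi) ^ (-((d : ℝ) - 1) / 2) * |A.det|⁻¹ *
        ((N : ℝ) ^ (-((d : ℝ) - 1) / 2) * Real.sqrt N ^ (d - 1)) * I := by rw [this, mul_one]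
    _ = _ := by ring

theorem quad_form {d : ℕ} [NeZero d]
    (H : Matrix (Fin d) (Fin d) ℝ) (hH : H.IsSymm)
    (u : Fin d → Fin d → ℝ) (lam : Fin d → ℝ)
    (horth : ∀ i j, u i ⬝ᵥ u j = if i = j then (1 : ℝ) else 0)
    (heig0 : H *ᵥ u 0 = (-(lam 0)) • u 0)
    (heig : ∀ k, k ≠ 0 → H *ᵥ u k = lam k • u k)
    (α : ℝ) (v : Fin d → ℝ) (y : Fin d → ℝ) :
    y ⬝ᵥ ((H + α • vecMulVec v v) *ᵥ y) = -lam 0 * (u 0 ⬝ᵥ y) ^ 2 +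
      ∑ j ∈ Finset.univ.erase 0, lam j * (u j ⬝ᵥ y) ^ 2 +
      α * ((v ⬝ᵥ u 0) * (u 0 ⬝ᵥ y) + ∑ j ∈ Finset.univ.erase 0, (v ⬝ᵥ u j) * (u j ⬝ᵥ y)) ^ 2 := by
  let U : Matrix (Fin d) (Fin d) ℝ := of u
  have hU : U * Uᵀ = 1 := by
    ext i j
    rw [Matrix.mul_apply, Matrix.one_apply, ← horth i j]
    rfl
  have hU' : Uᵀ * U = 1 := mul_eq_one_comm.mp hU
  have hpars : ∀ p q : Fin d → ℝ, p ⬝ᵥ q = (u 0 ⬝ᵥ p) * (u 0 ⬝ᵥ q) +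
      ∑ j ∈ Finset.univ.erase 0, (u j ⬝ᵥ p) * (u j ⬝ᵥ q) := by
    intro p q
    rw [Finset.add_sum_erase _ (fun j => (u j ⬝ᵥ p) * (u j ⬝ᵥ q)) (Finset.mem_univ 0)]
    change _ = (U *ᵥ p) ⬝ᵥ (U *ᵥ q)
    rw [dotProduct_mulVec, vecMul_mulVec, ← mulVec_transpose] 
    simp [hU']
  have hsym : ∀ p q : Fin d → ℝ, p ⬝ᵥ (H *ᵥ q) = (H *ᵥ p) ⬝ᵥ q := by
    intro p q
    rw [dotProduct_mulVec, ← mulVec_transpose, hH.eq]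
  rw [add_mulVec, dotProduct_add, smul_mulVec, dotProduct_smul, vecMulVec_mulVec]
  congr 1
  · rw [hpars y (H *ᵥ y)]
    congr 1
    · rw [hsym, heig0, smul_dotProduct, smul_eq_mul]; ring
    · refine Finset.sum_congr rfl fun j hj => ?_
      rw [hsym, heig j (Finset.ne_of_mem_erase hj), smul_dotProduct, smul_eq_mul]; ring
  · rw [smul_eq_mul]
    congr 1
    have : (v ⬝ᵥ u 0) * (u 0 ⬝ᵥ y) + ∑ j ∈ Finset.univ.erase 0, (v ⬝ᵥ u j) * (u j ⬝ᵥ y) = v ⬝ᵥ y := by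
      rw [hpars v y]
      simp only [dotProduct_comm v]
    rw [this]
    simp [dotProduct_smul, dotProduct_comm y v, sq]

theorem exists_A {d : ℕ} [NeZero d]
    (H : Matrix (Fin d) (Fin d) ℝ) (hH : H.IsSymm)
    (u : Fin d → Fin d → ℝ) (lam : Fin d → ℝ) (hlam : ∀ k, 0 < lam k)
    (horth : ∀ i j, u i ⬝ᵥ u j = if i = j then (1 : ℝ) else 0)
    (heig0 : H *ᵥ u 0 = (-(lam 0)) • u 0)
    (heig : ∀ k, k ≠ 0 → H *ᵥ u k = lam k • u k)
    (α : ℝ) (hα : 0 < α) (v : Fin d → ℝ) (hv1 : 0 < v ⬝ᵥ u 0)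
    (hvrel : (v ⬝ᵥ u 0) ^ 2 / lam 0 =
      ∑ k ∈ Finset.univ.erase 0, (v ⬝ᵥ u k) ^ 2 / lam k + 1 / α) :
    ∃ (A : Matrix (Fin d) (Fin d) ℝ) (m : Fin d → ℝ), A 0 = u 0 ∧
      |A.det| = (v ⬝ᵥ u 0) * Real.sqrt (α * (∏ k ∈ Finset.univ.erase 0, lam k) / lam 0) ∧
      (∀ y, ∑ j ∈ Finset.univ.erase 0, (A *ᵥ y) j ^ 2 = y ⬝ᵥ ((H + α • vecMulVec v v) *ᵥ y)) ∧
      (∀ y, ∑ j ∈ Finset.univ.erase 0, lam j * (u j ⬝ᵥ y - m j * (u 0 ⬝ᵥ y)) ^ 2 ≤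
        y ⬝ᵥ ((H + α • vecMulVec v v) *ᵥ y)) ∧
      ∑ j ∈ Finset.univ.erase 0, lam j * m j ^ 2 ≤ lam 0 := by
  have hQ := quad_form H hH u lam horth heig0 heig α v
  set V : Fin d → ℝ := fun j => v ⬝ᵥ u j with hV
  change 0 < V 0 at hv1
  have hl0 := hlam 0
  set B := ∑ k ∈ Finset.univ.erase 0, V k ^ 2 / lam k with hB
  have hBrel : B = V 0 ^ 2 / lam 0 - 1 / α := by
    rw [hvrel]; ring
  have hB0 : 0 ≤ B := Finset.sum_nonneg fun k _ => div_nonneg (sq_nonneg _) (hlam k).le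
  set σ := Real.sqrt (1 + α * B) with hσ
  have hσ2 : σ ^ 2 = 1 + α * B := Real.sq_sqrt (by positivity)
  have hσ0 : 0 ≤ σ := Real.sqrt_nonneg _
  obtain ⟨β, hβ⟩ : ∃ β, β = α / (σ + 1) := ⟨_, rfl⟩
  have hβ1 : 1 + β * B = σ := by
    rw [hβ]; field_simp; linear_combination -hσ2
  have hβ2 : 2 * β + β ^ 2 * B = α := by
    have : β * (1 + σ) = α := by rw [hβ]; field_simp; ring
    linear_combination this + β * hβ1
  let μ : Fin d → ℝ := fun j => if j = 0 then 1 else Real.sqrt (lam j)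
  let bb : Fin d → ℝ := fun j => if j = 0 then 0 else V j / Real.sqrt (lam j)
  let m : Fin d → ℝ := fun j => if j = 0 then 0 else -(lam 0 * V j / (V 0 * lam j))
  let e0 : Fin d → ℝ := Pi.single 0 1
  let U : Matrix (Fin d) (Fin d) ℝ := of u
  let A := (1 + vecMulVec (β • bb) bb) * (diagonal μ * ((1 + vecMulVec (-m) e0) * U))
  have hAy : ∀ y j, (A *ᵥ y) j = μ j * (u j ⬝ᵥ y - m j * (u 0 ⬝ᵥ y)) +
      β * bb j * ∑ k ∈ Finset.univ.erase 0, V k * (u k ⬝ᵥ y - m k * (u 0 ⬝ᵥ y)) := by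
    intro y j
    have hw : ((1 + vecMulVec (-m) e0) *ᵥ (U *ᵥ y)) = fun j => (u j ⬝ᵥ y - m j * (u 0 ⬝ᵥ y)) := by
      ext j
      rw [add_mulVec, one_mulVec, vecMulVec_mulVec]
      simp [e0, U, mulVec, sub_eq_add_neg]
      exact mul_comm _ _
    have hx : (diagonal μ * ((1 + vecMulVec (-m) e0) * U)) *ᵥ y =
        fun j => μ j * (u j ⬝ᵥ y - m j * (u 0 ⬝ᵥ y)) := by
      rw [← mulVec_mulVec, ← mulVec_mulVec, hw]
      ext j; rw [mulVec_diagonal]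
    simp only [A]
    rw [← mulVec_mulVec, hx, add_mulVec, one_mulVec, vecMulVec_mulVec]
    simp only [Pi.add_apply, Pi.smul_apply, MulOpposite.smul_eq_mul_unop, MulOpposite.unop_op, smul_eq_mul]
    congr 2
    unfold dotProduct
    rw [← Finset.add_sum_erase _ _ (Finset.mem_univ 0)]
    have h0 : bb 0 = 0 := by simp [bb]
    rw [h0, zero_mul, zero_add]
    refine Finset.sum_congr rfl fun k hk => ?_
    have hk0 := Finset.ne_of_mem_erase hk
    have := Real.sqrt_pos.mpr (hlam k)
    simp only [bb, μ, hk0, if_false]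
    field_simp
  have hform : ∀ y, y ⬝ᵥ ((H + α • vecMulVec v v) *ᵥ y) =
      ∑ j ∈ Finset.univ.erase 0, lam j * (u j ⬝ᵥ y - m j * (u 0 ⬝ᵥ y)) ^ 2 +
      α * (∑ k ∈ Finset.univ.erase 0, V k * (u k ⬝ᵥ y - m k * (u 0 ⬝ᵥ y))) ^ 2 := by
    intro y
    rw [hQ y]
    set η := u 0 ⬝ᵥ y
    set p := ∑ k ∈ Finset.univ.erase 0, V k * (u k ⬝ᵥ y - m k * η) with hp
    have e1 : ∑ j ∈ Finset.univ.erase 0, V j * (u j ⬝ᵥ y) = p - η * (lam 0 / V 0) * B := by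
      rw [hp, hB, Finset.mul_sum, ← Finset.sum_sub_distrib]
      refine Finset.sum_congr rfl fun k hk => ?_
      have := hlam k
      simp only [m, Finset.ne_of_mem_erase hk, if_false]
      field_simp
      ring
    have e2 : ∑ j ∈ Finset.univ.erase 0, lam j * (u j ⬝ᵥ y) ^ 2 =
        ∑ j ∈ Finset.univ.erase 0, lam j * (u j ⬝ᵥ y - m j * η) ^ 2 - 2 * η * (lam 0 / V 0) * p
          + η ^ 2 * (lam 0 / V 0) ^ 2 * B := by
      rw [hp, hB, Finset.mul_sum, Finset.mul_sum, ← Finset.sum_sub_distrib, ← Finset.sum_add_distrib]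
      refine Finset.sum_congr rfl fun k hk => ?_
      have := hlam k
      simp only [m, Finset.ne_of_mem_erase hk, if_false]
      field_simp
      ring
    change _ + _ + α * (V 0 * η + ∑ j ∈ Finset.univ.erase 0, V j * (u j ⬝ᵥ y)) ^ 2 = _
    rw [e1, e2, hBrel]
    field_simp
    ring
  have hU : |U.det| = 1 := by
    have hU : U * Uᵀ = 1 := by
      ext i j
      rw [Matrix.mul_apply, Matrix.one_apply, ← horth i j]
      rfl
    have := congrArg det hU
    rw [det_mul, det_transpose, det_one] at this
    rw [← abs_one, ← sq_eq_sq_iff_abs_eq_abs]; linear_combination this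
  have hbb : bb ⬝ᵥ bb = B := by
    unfold dotProduct
    rw [← Finset.add_sum_erase _ _ (Finset.mem_univ 0)]
    simp only [bb, if_true, zero_mul, zero_add]
    rw [hB]
    refine Finset.sum_congr rfl fun k hk => ?_
    simp only [Finset.ne_of_mem_erase hk, if_false]
    rw [div_mul_div_comm, Real.mul_self_sqrt (hlam k).le, sq]
  have hbbsum : ∑ j ∈ Finset.univ.erase 0, bb j ^ 2 = B := by
    rw [← hbb]
    unfold dotProduct
    rw [← Finset.add_sum_erase _ _ (Finset.mem_univ 0)]
    have h0 : bb 0 = 0 := by simp [bb]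
    rw [h0, zero_mul, zero_add]
    exact Finset.sum_congr rfl fun k _ => sq _
  have hdet : ∀ p q : Fin d → ℝ, (1 + vecMulVec p q).det = 1 + q ⬝ᵥ p := by
    intro p q
    rw [vecMulVec_eq Unit, det_one_add_replicateCol_mul_replicateRow]
  refine ⟨A, m, ?_, ?_, ?_, ?_, ?_⟩
  · ext i
    have := hAy (Pi.single i 1) 0
    simpa [μ, bb, m, mulVec] using this
  · have h1 : A.det = σ * ((∏ j, μ j) * (1 * U.det)) := by
      simp only [A]
      rw [det_mul, det_mul, det_mul, hdet, hdet, det_diagonal, dotProduct_smul, hbb, smul_eq_mul, hβ1]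
      simp [e0, m]
    have h2 : ∏ j, μ j = Real.sqrt (∏ k ∈ Finset.univ.erase 0, lam k) := by
      rw [← Finset.mul_prod_erase _ _ (Finset.mem_univ 0), Real.sqrt_prod _ (fun k _ => (hlam k).le)]
      simp only [μ, if_true, one_mul]
      refine Finset.prod_congr rfl fun k hk => ?_
      simp only [Finset.ne_of_mem_erase hk, if_false]
    have hpr : 0 ≤ ∏ k ∈ Finset.univ.erase 0, lam k := Finset.prod_nonneg fun k _ => (hlam k).le
    rw [h1, abs_mul, abs_mul, one_mul, hU, mul_one, h2, abs_of_nonneg hσ0, abs_of_nonneg (Real.sqrt_nonneg _),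
      hσ, ← Real.sqrt_mul (by positivity)]
    change _ = V 0 * _
    rw [← Real.sqrt_sq hv1.le, ← Real.sqrt_mul (by positivity)]
    congr 1
    rw [hBrel]
    field_simp
    ring
  · intro y
    rw [hform]
    set p := ∑ k ∈ Finset.univ.erase 0, V k * (u k ⬝ᵥ y - m k * (u 0 ⬝ᵥ y)) with hp
    have e : ∀ j ∈ Finset.univ.erase 0, (A *ᵥ y) j ^ 2 = lam j * (u j ⬝ᵥ y - m j * (u 0 ⬝ᵥ y)) ^ 2 +
        2 * β * p * (V j * (u j ⬝ᵥ y - m j * (u 0 ⬝ᵥ y))) + β ^ 2 * p ^ 2 * bb j ^ 2 := by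
      intro j hj
      rw [hAy, ← hp]
      have h1 : μ j ^ 2 = lam j := by
        simp only [μ, Finset.ne_of_mem_erase hj, if_false]; exact Real.sq_sqrt (hlam j).le
      have h2 : μ j * bb j = V j := by
        have := Real.sqrt_pos.mpr (hlam j)
        simp only [μ, bb, Finset.ne_of_mem_erase hj, if_false]; field_simp
      rw [← h1, ← h2]; ring
    rw [Finset.sum_congr rfl e, Finset.sum_add_distrib, Finset.sum_add_distrib, ← Finset.mul_sum,
      ← Finset.mul_sum, hbbsum, ← hp, ← hβ2]
    ring
  · intro y
    rw [hform]
    have : 0 ≤ α * (∑ k ∈ Finset.univ.erase 0, V k * (u k ⬝ᵥ y - m k * (u 0 ⬝ᵥ y))) ^ 2 := by positivity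
    linarith
  · have : ∑ j ∈ Finset.univ.erase 0, lam j * m j ^ 2 = (lam 0 / V 0) ^ 2 * B := by
      rw [hB, Finset.mul_sum]
      refine Finset.sum_congr rfl fun k hk => ?_
      have := hlam k
      simp only [m, Finset.ne_of_mem_erase hk, if_false]
      field_simp
    rw [this, hBrel]
    have : (lam 0 / V 0) ^ 2 * (V 0 ^ 2 / lam 0 - 1 / α) = lam 0 - (lam 0 / V 0) ^ 2 * (1 / α) := by
      field_simp
    rw [this]
    have : 0 ≤ (lam 0 / V 0) ^ 2 * (1 / α) := by positivity
    linarith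

theorem pos_case {d : ℕ} [NeZero d]
    (H : Matrix (Fin d) (Fin d) ℝ) (hH : H.IsSymm)
    (u : Fin d → Fin d → ℝ) (lam : Fin d → ℝ) (hlam : ∀ k, 0 < lam k)
    (horth : ∀ i j, u i ⬝ᵥ u j = if i = j then (1 : ℝ) else 0)
    (heig0 : H *ᵥ u 0 = (-(lam 0)) • u 0)
    (heig : ∀ k, k ≠ 0 → H *ᵥ u k = lam k • u k)
    (α : ℝ) (hα : 0 < α) (v : Fin d → ℝ) (hv1 : 0 < v ⬝ᵥ u 0)
    (hvrel : (v ⬝ᵥ u 0) ^ 2 / lam 0 =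
      ∑ k ∈ Finset.univ.erase 0, (v ⬝ᵥ u k) ^ 2 / lam k + 1 / α)
    (ε : ℕ → ℝ) (hε : ∀ N, 0 < ε N)
    (h1 : Tendsto (fun N : ℕ => (N : ℝ) * ε N ^ 2) atTop atTop)
    (z : Fin d → ℤ) (a : ℝ) (ha : 0 < a) (r : ℝ) (hr : 0 < r)
    (hz : 0 < u 0 ⬝ᵥ (fun i => (z i : ℝ))) (t : ℕ → ℝ) (ht : ∀ N : ℕ, |t N| ≤ ε N + r / N) :
    Tendsto (fun N : ℕ => (2 * Real.pi * N) ^ (-((d : ℝ) - 1) / 2) *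
        ∑' x : {x : Fin d → ℝ //
          (t N ≤ x ⬝ᵥ u 0 ∧ x ⬝ᵥ u 0 < t N + (fun i => (z i : ℝ) / N) ⬝ᵥ u 0) ∧
          (∀ i, ∃ k : ℤ, x i = k / N) ∧
          ∑ j ∈ Finset.univ.erase 0, lam j * (x ⬝ᵥ u j) ^ 2 ≤
            (1 + a) * lam 0 * ε N ^ 2},
          Real.exp (-(N : ℝ) / 2 *
            (x.1 ⬝ᵥ ((H + α • vecMulVec v v) *ᵥ x.1))))
      atTop
      (nhds ((u 0 ⬝ᵥ (fun i => (z i : ℝ))) / (u 0 ⬝ᵥ v) *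
        Real.sqrt (lam 0 / (α * ∏ k ∈ Finset.univ.erase 0, lam k)))) := by
  obtain ⟨A, m, hA0, hdet, hAq, hlow, hm⟩ := exists_A H hH u lam hlam horth heig0 heig α hα v hv1 hvrel
  set c := u 0 ⬝ᵥ (fun i => (z i : ℝ)) with hc
  have hprod : 0 < ∏ k ∈ Finset.univ.erase 0, lam k := Finset.prod_pos fun k _ => hlam k
  have hl0 := hlam 0
  have hdpos : 0 < |A.det| := by rw [hdet]; positivity
  have hdne : A.det ≠ 0 := abs_pos.mp hdpos
  have hlimval : c / (u 0 ⬝ᵥ v) * Real.sqrt (lam 0 / (α * ∏ k ∈ Finset.univ.erase 0, lam k)) =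
      c / |A.det| := by
    rw [hdet, dotProduct_comm (u 0) v, ← div_div c, div_eq_mul_inv (c / (v ⬝ᵥ u 0)), ← Real.sqrt_inv, inv_div]
  rw [hlimval]
  have hcast : ∀ (N : ℕ) (k : Fin d → ℤ) (j : Fin d),
      (fun i => (k i : ℝ) / N) ⬝ᵥ u j = (u j ⬝ᵥ (fun i => (k i : ℝ))) / N := by
    intro N k j
    unfold dotProduct
    rw [Finset.sum_div]
    exact Finset.sum_congr rfl fun i _ => by ring
  let C : ℕ → Set (Fin d → ℤ) := fun N => {k | ∑ j ∈ Finset.univ.erase 0,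
    lam j * ((fun i => (k i : ℝ) / N) ⬝ᵥ u j) ^ 2 ≤ (1 + a) * lam 0 * ε N ^ 2}
  have hX2 : Tendsto (fun N : ℕ => ((N : ℝ) * ε N) ^ 2) atTop atTop := by
    refine tendsto_atTop_mono' _ ?_ h1
    filter_upwards [eventually_ge_atTop 1] with N hN
    have h1N : (1 : ℝ) ≤ N := by exact_mod_cast hN
    have : 0 ≤ (N : ℝ) * ε N ^ 2 := by positivity
    calc (N : ℝ) * ε N ^ 2 ≤ N * (N * ε N ^ 2) := le_mul_of_one_le_left this h1N
      _ = _ := by ring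
  have hX : Tendsto (fun N : ℕ => (N : ℝ) * ε N) atTop atTop := by
    refine (Real.tendsto_sqrt_atTop.comp hX2).congr fun N => ?_
    exact Real.sqrt_sq (mul_nonneg (Nat.cast_nonneg N) (hε N).le)
  have hC : ∀ K : ℝ, ∀ᶠ N : ℕ in atTop, ∀ k ∈ zslab (A 0) (N * t N) c,
      (∀ j, j ≠ 0 → |(A *ᵥ (fun i => (k i : ℝ))) j| ≤ K * Real.sqrt N) → k ∈ C N := by
    intro K
    have hlim1 : Tendsto (fun N : ℕ => (1 + a / 2) * (1 + (r + c) / ((N : ℝ) * ε N)) ^ 2) atTop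
        (nhds ((1 + a / 2) * (1 + 0) ^ 2)) :=
      ((hX.const_div_atTop (r + c)).const_add 1).pow 2 |>.const_mul _
    have hev1 := hlim1.eventually (eventually_le_nhds (b := 1 + 3 * a / 4) (by linarith))
    have hev2 := h1.eventually_ge_atTop ((1 + 2 / a) * (d * K ^ 2) / (a / 4 * lam 0))
    filter_upwards [hev1, hev2, eventually_gt_atTop 0] with N h3 h4 hN k hk hkj
    have hNp : (0 : ℝ) < N := by exact_mod_cast hN
    have hεN := hε N
    set η := u 0 ⬝ᵥ (fun i => (k i : ℝ)) with hη
    have hηb : |η| ≤ N * ε N + (r + c) := by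
      obtain ⟨hk1, hk2⟩ := hk
      rw [hA0] at hk1 hk2
      have hNt : |(N : ℝ) * t N| ≤ N * ε N + r := by
        rw [abs_mul, abs_of_pos hNp]
        calc (N : ℝ) * |t N| ≤ N * (ε N + r / N) := mul_le_mul_of_nonneg_left (ht N) hNp.le
          _ = _ := by field_simp
      rw [abs_le] at hNt ⊢
      constructor <;> linarith
    have hη2 : (1 + a / 2) * η ^ 2 ≤ (1 + 3 * a / 4) * (N * ε N) ^ 2 := by
      have hXp : 0 < (N : ℝ) * ε N := by positivity
      have e1 : η ^ 2 ≤ (N * ε N + (r + c)) ^ 2 := sq_le_sq.mpr (by rwa [abs_of_pos (by positivity : 0 < (N : ℝ) * ε N + (r + c))])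
      have e2 : ((N : ℝ) * ε N + (r + c)) ^ 2 = (1 + (r + c) / ((N : ℝ) * ε N)) ^ 2 * (N * ε N) ^ 2 := by
        field_simp
      calc (1 + a / 2) * η ^ 2 ≤ (1 + a / 2) * ((1 + (r + c) / ((N : ℝ) * ε N)) ^ 2 * (N * ε N) ^ 2) := by
            rw [← e2]; exact mul_le_mul_of_nonneg_left e1 (by positivity)
        _ = ((1 + a / 2) * (1 + (r + c) / ((N : ℝ) * ε N)) ^ 2) * (N * ε N) ^ 2 := by ring
        _ ≤ _ := mul_le_mul_of_nonneg_right h3 (by positivity)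
    have hq : ∑ j ∈ Finset.univ.erase 0, lam j * (u j ⬝ᵥ (fun i => (k i : ℝ)) - m j * η) ^ 2 ≤
        d * K ^ 2 * N := by
      refine (hlow _).trans ?_
      rw [← hAq]
      calc _ ≤ ∑ j ∈ Finset.univ.erase (0 : Fin d), K ^ 2 * N := by
            refine Finset.sum_le_sum fun j hj => ?_
            have := hkj j (Finset.ne_of_mem_erase hj)
            calc _ ≤ (K * Real.sqrt N) ^ 2 := by
                  apply sq_le_sq.mpr
                  exact this.trans (le_abs_self _)
              _ = _ := by rw [mul_pow, Real.sq_sqrt hNp.le]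
        _ ≤ _ := by
            rw [Finset.sum_const, nsmul_eq_mul, mul_assoc (d : ℝ)]
            apply mul_le_mul_of_nonneg_right _ (by positivity)
            have := Finset.card_erase_le (s := (Finset.univ : Finset (Fin d))) (a := 0)
            simp only [Finset.card_univ, Fintype.card_fin] at this
            exact_mod_cast this
    have hkey : ∑ j ∈ Finset.univ.erase 0, lam j * (u j ⬝ᵥ (fun i => (k i : ℝ))) ^ 2 ≤
        (1 + 2 / a) * (d * K ^ 2 * N) + (1 + a / 2) * η ^ 2 * lam 0 := by
      calc _ ≤ ∑ j ∈ Finset.univ.erase 0, ((1 + 2 / a) * (lam j * (u j ⬝ᵥ (fun i => (k i : ℝ)) - m j * η) ^ 2) +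
              (1 + a / 2) * η ^ 2 * (lam j * m j ^ 2)) := by
            refine Finset.sum_le_sum fun j hj => ?_
            set p := u j ⬝ᵥ (fun i => (k i : ℝ))
            have hid : (1 + 2 / a) * (lam j * (p - m j * η) ^ 2) + (1 + a / 2) * η ^ 2 * (lam j * m j ^ 2)
                - lam j * p ^ 2 = lam j * (2 / a) * ((p - m j * η) - a / 2 * (m j * η)) ^ 2 := by
              field_simp
              ring
            have hlj := hlam j
            have : 0 ≤ lam j * (2 / a) * ((p - m j * η) - a / 2 * (m j * η)) ^ 2 := by positivity
            linarith
        _ = (1 + 2 / a) * (∑ j ∈ Finset.univ.erase 0, lam j * (u j ⬝ᵥ (fun i => (k i : ℝ)) - m j * η) ^ 2) +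
              (1 + a / 2) * η ^ 2 * ∑ j ∈ Finset.univ.erase 0, lam j * m j ^ 2 := by
            rw [Finset.sum_add_distrib, ← Finset.mul_sum, ← Finset.mul_sum]
        _ ≤ _ := add_le_add (mul_le_mul_of_nonneg_left hq (by positivity))
            (mul_le_mul_of_nonneg_left hm (by positivity))
    rw [div_le_iff₀ (by positivity)] at h4
    change ∑ j ∈ Finset.univ.erase 0, lam j * ((fun i => (k i : ℝ) / N) ⬝ᵥ u j) ^ 2 ≤ _
    have hscale : ∑ j ∈ Finset.univ.erase 0, lam j * ((fun i => (k i : ℝ) / N) ⬝ᵥ u j) ^ 2 =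
        (∑ j ∈ Finset.univ.erase 0, lam j * (u j ⬝ᵥ (fun i => (k i : ℝ))) ^ 2) / N ^ 2 := by
      rw [Finset.sum_div]
      refine Finset.sum_congr rfl fun j _ => ?_
      rw [hcast]; ring
    rw [hscale, div_le_iff₀ (by positivity)]
    have e3 := mul_le_mul_of_nonneg_right h4 hNp.le
    have e4 := mul_le_mul_of_nonneg_right hη2 hl0.le
    nlinarith
  have hzA : A 0 ⬝ᵥ (fun i => (z i : ℝ)) = c := by rw [hA0]
  have hmain := abstract_limit A hdne z c hz hzA (fun N => N * t N) C hC
  refine hmain.congr' ?_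
  filter_upwards [eventually_gt_atTop 0] with N hN
  have hNp : (0 : ℝ) < N := by exact_mod_cast hN
  congr 1
  rw [tsum_subtype (zslab (A 0) (N * t N) c), Set.indicator_indicator, ← tsum_subtype]
  have hiff : ∀ k : Fin d → ℤ, k ∈ zslab (A 0) (N * t N) c ↔
      t N ≤ (fun i => (k i : ℝ) / N) ⬝ᵥ u 0 ∧
        (fun i => (k i : ℝ) / N) ⬝ᵥ u 0 < t N + (fun i => (z i : ℝ) / N) ⬝ᵥ u 0 := by
    intro k
    rw [hcast, hcast, ← hc, le_div_iff₀ hNp, ← sub_lt_iff_lt_add, ← sub_div, div_lt_iff₀ hNp]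
    simp only [zslab, Set.mem_ofPred_eq, hA0]
    constructor <;> rintro ⟨e1, e2⟩ <;> constructor <;> linarith
  let S := zslab (A 0) (N * t N) c ∩ C N
  let P : (Fin d → ℝ) → Prop := fun x =>
    (t N ≤ x ⬝ᵥ u 0 ∧ x ⬝ᵥ u 0 < t N + (fun i => (z i : ℝ) / N) ⬝ᵥ u 0) ∧
          (∀ i, ∃ k : ℤ, x i = k / N) ∧
          ∑ j ∈ Finset.univ.erase 0, lam j * (x ⬝ᵥ u j) ^ 2 ≤
            (1 + a) * lam 0 * ε N ^ 2
  let e : S → {x // P x} := fun k => ⟨fun i => (k.1 i : ℝ) / N, (hiff _).mp k.2.1, fun i => ⟨_, rfl⟩, k.2.2⟩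
  have he : Function.Bijective e := by
    constructor
    · intro k k' hkk
      ext i
      have := congrFun (congrArg Subtype.val hkk) i
      simp only [e] at this
      rw [div_left_inj' hNp.ne'] at this
      exact_mod_cast this
    · rintro ⟨x, hx1, hx2, hx3⟩
      have hx2' := hx2
      choose k hk using hx2'
      have hxk : x = fun i => (k i : ℝ) / N := funext hk
      subst hxk
      exact ⟨⟨k, (hiff k).mpr hx1, hx3⟩, rfl⟩
  have := (Equiv.ofBijective e he).tsum_eq (fun x : {x // P x} =>
    Real.exp (-(N : ℝ) / 2 * (x.1 ⬝ᵥ ((H + α • vecMulVec v v) *ᵥ x.1))))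
  refine Eq.trans ?_ this
  refine tsum_congr fun k => ?_
  rw [hAq]
  congr 1
  have hx : (fun i => (k.1 i : ℝ) / N) = (N : ℝ)⁻¹ • (fun i => (k.1 i : ℝ)) := by
    ext i; simp [div_eq_inv_mul]
  simp only [Equiv.ofBijective_apply, e]
  rw [hx, mulVec_smul, dotProduct_smul, smul_dotProduct, smul_eq_mul, smul_eq_mul]
  field_simp

theorem tsum_congr_pred {X : Type*} (f : X → ℝ) {P Q : X → Prop} (h : ∀ x, P x ↔ Q x) :
    ∑' x : {x // P x}, f x.1 = ∑' x : {x // Q x}, f x.1 := by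
  have : P = Q := funext fun x => propext (h x)
  subst this
  rfl

/-- Paper's Lemma 3.4: degenerate-Gaussian slice asymptotics.  For the
degenerate quadratic form `H + α v vᵀ` associated with a saddle point, the sum
of `e^{-(N/2) xᵀ(H + α v vᵀ)x}` over lattice points of the slab
`P_{t_N}(N⁻¹ z) ∩ 𝒜_N(a)`, normalized by `(2πN)^{-(d-1)/2}`, converges to
`(|u₁·z|/(u₁·v)) √(λ₁/(α ∏_{k≥2} λ_k))`. -/
theorem degenerate_gaussian_slab_asymptotics {d : ℕ} [NeZero d]
    (H : Matrix (Fin d) (Fin d) ℝ) (hH : H.IsSymm)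
    (u : Fin d → Fin d → ℝ) (lam : Fin d → ℝ) (hlam : ∀ k, 0 < lam k)
    (horth : ∀ i j, u i ⬝ᵥ u j = if i = j then (1 : ℝ) else 0)
    (heig0 : H *ᵥ u 0 = (-(lam 0)) • u 0)
    (heig : ∀ k, k ≠ 0 → H *ᵥ u k = lam k • u k)
    (α : ℝ) (hα : 0 < α) (v : Fin d → ℝ) (hv1 : 0 < v ⬝ᵥ u 0)
    (hvrel : (v ⬝ᵥ u 0) ^ 2 / lam 0 =
      ∑ k ∈ Finset.univ.erase 0, (v ⬝ᵥ u k) ^ 2 / lam k + 1 / α)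
    (ε : ℕ → ℝ) (hε : ∀ N, 0 < ε N)
    (h1 : Tendsto (fun N : ℕ => (N : ℝ) * ε N ^ 2) atTop atTop)
    (h2 : Tendsto (fun N : ℕ => (N : ℝ) * ε N ^ 3) atTop (nhds 0))
    (z : Fin d → ℤ) (a : ℝ) (ha : 0 < a) (r : ℝ) (hr : 0 < r)
    (t : ℕ → ℝ) (ht : ∀ N : ℕ, |t N| ≤ ε N + r / N) :
    Tendsto (fun N : ℕ => (2 * Real.pi * N) ^ (-((d : ℝ) - 1) / 2) *
        ∑' x : {x : Fin d → ℝ //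
          (if 0 ≤ (fun i => (z i : ℝ) / N) ⬝ᵥ u 0 then
            t N ≤ x ⬝ᵥ u 0 ∧ x ⬝ᵥ u 0 < t N + (fun i => (z i : ℝ) / N) ⬝ᵥ u 0
          else
            t N + (fun i => (z i : ℝ) / N) ⬝ᵥ u 0 < x ⬝ᵥ u 0 ∧ x ⬝ᵥ u 0 ≤ t N) ∧
          (∀ i, ∃ k : ℤ, x i = k / N) ∧
          ∑ j ∈ Finset.univ.erase 0, lam j * (x ⬝ᵥ u j) ^ 2 ≤
            (1 + a) * lam 0 * ε N ^ 2},
          Real.exp (-(N : ℝ) / 2 *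
            (x.1 ⬝ᵥ ((H + α • vecMulVec v v) *ᵥ x.1))))
      atTop
      (nhds (|u 0 ⬝ᵥ (fun i => (z i : ℝ))| / (u 0 ⬝ᵥ v) *
        Real.sqrt (lam 0 / (α * ∏ k ∈ Finset.univ.erase 0, lam k)))) := by
  rcases lt_trichotomy (u 0 ⬝ᵥ (fun i => (z i : ℝ))) 0 with hc | hc | hc
  · have hneg : (fun i => ((-z) i : ℝ)) = -(fun i => (z i : ℝ)) := by ext i; simp
    have hz' : 0 < u 0 ⬝ᵥ (fun i => ((-z) i : ℝ)) := by
      rw [hneg, dotProduct_neg]; linarith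
    have key := pos_case H hH u lam hlam horth heig0 heig α hα v hv1 hvrel ε hε h1 (-z) a ha r hr
      hz' (fun N => -t N) (fun N => by rw [abs_neg]; exact ht N)
    rw [abs_of_neg hc, ← dotProduct_neg, ← hneg]
    refine key.congr' ?_
    filter_upwards [eventually_gt_atTop 0] with N hN
    have hNp : (0 : ℝ) < N := by exact_mod_cast hN
    have hdiv : (fun i => (z i : ℝ) / N) ⬝ᵥ u 0 = (u 0 ⬝ᵥ (fun i => (z i : ℝ))) / N := by
      unfold dotProduct
      rw [Finset.sum_div]
      exact Finset.sum_congr rfl fun i _ => by ring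
    have hlt : ¬ 0 ≤ (fun i => (z i : ℝ) / N) ⬝ᵥ u 0 := by
      rw [hdiv, not_le]; exact div_neg_of_neg_of_pos hc hNp
    have hzz : (fun i => ((-z) i : ℝ) / N) = -(fun i => (z i : ℝ) / N) := by
      ext i; simp [neg_div]
    congr 1
    refine Eq.trans ?_ (tsum_congr_pred (fun x => Real.exp (-(N : ℝ) / 2 * (x ⬝ᵥ ((H + α • vecMulVec v v) *ᵥ x))))
      (fun x => and_congr_left' (by rw [if_neg hlt])))
    let e := Equiv.subtypeEquiv (Equiv.neg (Fin d → ℝ))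
      (p := fun x => (-t N ≤ x ⬝ᵥ u 0 ∧ x ⬝ᵥ u 0 < -t N + (fun i => ((-z) i : ℝ) / N) ⬝ᵥ u 0) ∧
          (∀ i, ∃ k : ℤ, x i = k / N) ∧
          ∑ j ∈ Finset.univ.erase 0, lam j * (x ⬝ᵥ u j) ^ 2 ≤ (1 + a) * lam 0 * ε N ^ 2)
      (q := fun x => (t N + (fun i => (z i : ℝ) / N) ⬝ᵥ u 0 < x ⬝ᵥ u 0 ∧ x ⬝ᵥ u 0 ≤ t N) ∧
          (∀ i, ∃ k : ℤ, x i = k / N) ∧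
          ∑ j ∈ Finset.univ.erase 0, lam j * (x ⬝ᵥ u j) ^ 2 ≤ (1 + a) * lam 0 * ε N ^ 2)
      (by
        intro x
        rw [hzz]
        simp only [Equiv.neg_apply, neg_dotProduct, neg_sq, Pi.neg_apply]
        refine and_congr ?_ (and_congr (forall_congr' fun i => ?_) Iff.rfl)
        · constructor <;> rintro ⟨e1, e2⟩ <;> constructor <;> linarith
        · constructor
          · rintro ⟨k, hk⟩
            exact ⟨-k, by rw [hk]; push_cast; ring⟩
          · rintro ⟨k, hk⟩
            exact ⟨-k, by rw [← neg_neg (x i), hk]; push_cast; ring⟩)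
    have := e.tsum_eq (fun x => Real.exp (-(N : ℝ) / 2 *
            (x.1 ⬝ᵥ ((H + α • vecMulVec v v) *ᵥ x.1))))
    refine Eq.trans ?_ this
    refine tsum_congr fun x => ?_
    simp only [e, Equiv.subtypeEquiv_apply, Equiv.neg_apply, mulVec_neg, neg_dotProduct, dotProduct_neg,
      neg_neg]
  · rw [hc, abs_zero, zero_div, zero_mul]
    refine tendsto_const_nhds.congr fun N => ?_
    have hdiv : (fun i => (z i : ℝ) / N) ⬝ᵥ u 0 = 0 := by
      have : (fun i => (z i : ℝ) / N) ⬝ᵥ u 0 = (u 0 ⬝ᵥ (fun i => (z i : ℝ))) / N := by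
        unfold dotProduct
        rw [Finset.sum_div]
        exact Finset.sum_congr rfl fun i _ => by ring
      rw [this, hc, zero_div]
    symm
    apply mul_eq_zero_of_right
    refine (tsum_congr_pred (Q := fun _ => False) (fun x => Real.exp (-(N : ℝ) / 2 * (x ⬝ᵥ ((H + α • vecMulVec v v) *ᵥ x)))) ?_).trans tsum_empty
    intro x
    rw [hdiv, if_pos le_rfl, add_zero]
    refine ⟨?_, False.elim⟩
    rintro ⟨⟨e1, e2⟩, _⟩
    linarith
  · have key := pos_case H hH u lam hlam horth heig0 heig α hα v hv1 hvrel ε hε h1 z a ha r hr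
      hc t ht
    rw [abs_of_pos hc]
    refine key.congr fun N => ?_
    have hdiv : 0 ≤ (fun i => (z i : ℝ) / N) ⬝ᵥ u 0 := by
      have : (fun i => (z i : ℝ) / N) ⬝ᵥ u 0 = (u 0 ⬝ᵥ (fun i => (z i : ℝ))) / N := by
        unfold dotProduct
        rw [Finset.sum_div]
        exact Finset.sum_congr rfl fun i _ => by ring
      rw [this]
      exact div_nonneg hc.le (Nat.cast_nonneg N)
    congr 1
    exact tsum_congr_pred (fun x => Real.exp (-(N : ℝ) / 2 * (x ⬝ᵥ ((H + α • vecMulVec v v) *ᵥ x))))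
      (fun x => and_congr_left' (by rw [if_pos hdiv]))
end

section
/- Let H be a real symmetric d×d matrix with orthonormal eigenvectors u₁, …, u_d and eigenvalues −λ₁, λ₂, …, λ_d, where λ₁, …, λ_d > 0. Let α > 0 and v ∈ ℝᵈ with coordinates v_k = v·u_k satisfying v₁ > 0 and v₁²/λ₁ = ∑_{k=2}^d v_k²/λ_k + 1/α. Let (ε_N)_{N≥1} be positive reals with N ε_N² → ∞ and N ε_N³ → 0, and fix a > 0. Then there exists a finite constant C₀ such that for all N ≥ 1: (1/(N ε_N)) · N^{−(d−1)/2} · ∑_{x ∈ 𝓒_N} exp(−(N/2) xᵀ(H + α v vᵀ)x) ≤ C₀, where 𝓒_N = {x ∈ (N⁻¹ℤ)ᵈ : |x·u₁| ≤ ε_N and ∑_{j=2}^d λ_j (x·u_j)² ≤ (1+a) λ₁ ε_N²}. -/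
open Matrix Filter

/-- Parseval identity for a family orthonormal with respect to the dot product. -/
lemma dgb_parseval {d : ℕ} (u : Fin d → Fin d → ℝ)
    (horth : ∀ i j, u i ⬝ᵥ u j = if i = j then (1 : ℝ) else 0) (x y : Fin d → ℝ) :
    x ⬝ᵥ y = ∑ j, (x ⬝ᵥ u j) * (y ⬝ᵥ u j) := by
  have hU : (Matrix.of u) * (Matrix.of u)ᵀ = 1 := by
    ext i j
    rw [Matrix.mul_apply, Matrix.one_apply]
    simpa [dotProduct] using horth i j
  have hU2 : (Matrix.of u)ᵀ * (Matrix.of u) = 1 := mul_eq_one_comm.mp hU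
  have h3 : ∀ x : Fin d → ℝ, ∀ j, x ⬝ᵥ u j = ((Matrix.of u) *ᵥ x) j := by
    intro x j
    rw [dotProduct_comm]; rfl
  simp only [h3]
  change _ = ((Matrix.of u) *ᵥ x) ⬝ᵥ ((Matrix.of u) *ᵥ y)
  rw [Matrix.dotProduct_mulVec, ← Matrix.mulVec_transpose, Matrix.mulVec_mulVec, hU2,
    Matrix.one_mulVec]

/-- Coordinates of a vector synthesized from an orthonormal family. -/
lemma dgb_coord {d : ℕ} (u : Fin d → Fin d → ℝ)
    (horth : ∀ i j, u i ⬝ᵥ u j = if i = j then (1 : ℝ) else 0) (q : Fin d → ℝ) (j : Fin d) :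
    (∑ k, q k • u k) ⬝ᵥ u j = q j := by
  rw [sum_dotProduct]
  simp [smul_dotProduct, horth]

/-- Coercivity of the degenerate form transversally to its kernel. -/
lemma dgb_coercive {d : ℕ} [NeZero d]
    (H : Matrix (Fin d) (Fin d) ℝ) (hH : H.IsSymm)
    (u : Fin d → Fin d → ℝ) (lam : Fin d → ℝ) (hlam : ∀ k, 0 < lam k)
    (horth : ∀ i j, u i ⬝ᵥ u j = if i = j then (1 : ℝ) else 0)
    (heig0 : H *ᵥ u 0 = (-(lam 0)) • u 0)
    (heig : ∀ k, k ≠ 0 → H *ᵥ u k = lam k • u k)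
    (α : ℝ) (hα : 0 < α) (v : Fin d → ℝ) (hv1 : 0 < v ⬝ᵥ u 0)
    (hvrel : (v ⬝ᵥ u 0) ^ 2 / lam 0 =
      ∑ k ∈ Finset.univ.erase 0, (v ⬝ᵥ u k) ^ 2 / lam k + 1 / α) :
    ∃ (i : Fin d) (r : Fin d → ℝ) (c : ℝ), 0 < c ∧ ∀ x : Fin d → ℝ,
      c * ∑ j ∈ Finset.univ.erase i, (x j - r j * x i) ^ 2 ≤
        x ⬝ᵥ ((H + α • vecMulVec v v) *ᵥ x) := by
  set μ : Fin d → ℝ := fun k => if k = 0 then -(lam 0) else lam k with hμ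
  have hμ0 : ∀ k, μ k ≠ 0 := by
    intro k
    by_cases hk : k = 0
    · simp [hμ, hk, (hlam 0).ne']
    · simp [hμ, hk, (hlam k).ne']
  have hHu : ∀ k, H *ᵥ u k = μ k • u k := by
    intro k
    by_cases hk : k = 0
    · subst hk; simpa [hμ] using heig0
    · simpa [hμ, hk] using heig k hk
  set p : Fin d → ℝ := fun k => v ⬝ᵥ u k with hp
  have hrel : ∑ k, p k ^ 2 / μ k = - (1 / α) := by
    rw [← Finset.add_sum_erase _ _ (Finset.mem_univ (0 : Fin d))]
    have : ∑ k ∈ Finset.univ.erase 0, p k ^ 2 / μ k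
        = ∑ k ∈ Finset.univ.erase 0, (v ⬝ᵥ u k) ^ 2 / lam k := by
      refine Finset.sum_congr rfl fun k hk => ?_
      have : k ≠ 0 := Finset.ne_of_mem_erase hk
      simp [hμ, hp, this]
    rw [this]
    have : p 0 ^ 2 / μ 0 = -((v ⬝ᵥ u 0) ^ 2 / lam 0) := by
      simp [hμ, hp, div_neg]
    rw [this, hvrel]; ring
  set w : Fin d → ℝ := ∑ k, (p k / μ k) • u k with hw
  have hwc : ∀ j, w ⬝ᵥ u j = p j / μ j := dgb_coord u horth _
  have hw0 : w ⬝ᵥ u 0 ≠ 0 := by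
    rw [hwc]; exact div_ne_zero hv1.ne' (hμ0 0)
  obtain ⟨i, hi⟩ : ∃ i, w i ≠ 0 := by
    by_contra hcon
    push Not at hcon
    apply hw0
    simp [dotProduct, hcon]
  set L : ℝ := ∑ k, 1 / lam k with hL
  have hLk : ∀ k, 1 / lam k ≤ L := fun k =>
    Finset.single_le_sum (f := fun k => 1 / lam k)
      (fun k _ => (one_div_pos.mpr (hlam k)).le) (Finset.mem_univ k)
  have hLpos : 0 < L := lt_of_lt_of_le (one_div_pos.mpr (hlam 0)) (hLk 0)
  set r : Fin d → ℝ := fun j => w j / w i with hr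
  set S : ℝ := ∑ j, 2 * (1 + r j ^ 2) with hS
  have hSpos : 0 < S := Finset.sum_pos (fun j _ => by positivity) ⟨0, Finset.mem_univ 0⟩
  refine ⟨i, r, 1 / (S * L), by positivity, fun x => ?_⟩
  set s : ℝ := (x ⬝ᵥ u 0) / (w ⬝ᵥ u 0) with hs
  set Z : Fin d → ℝ := x - s • w with hZ
  have hZc : ∀ j, x ⬝ᵥ u j = Z ⬝ᵥ u j + s * (p j / μ j) := by
    intro j
    rw [hZ, sub_dotProduct, smul_dotProduct, hwc, smul_eq_mul]; ring
  have hZ0 : Z ⬝ᵥ u 0 = 0 := by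
    rw [hZ, sub_dotProduct, smul_dotProduct, smul_eq_mul, hs, div_mul_cancel₀ _ hw0, sub_self]
  -- the form
  have hform : x ⬝ᵥ ((H + α • vecMulVec v v) *ᵥ x)
      = ∑ j, μ j * (x ⬝ᵥ u j) ^ 2 + α * (v ⬝ᵥ x) ^ 2 := by
    rw [Matrix.add_mulVec, dotProduct_add, Matrix.smul_mulVec, dotProduct_smul,
      Matrix.vecMulVec_mulVec]
    congr 1
    · rw [dgb_parseval u horth]
      refine Finset.sum_congr rfl fun j _ => ?_
      have : (H *ᵥ x) ⬝ᵥ u j = μ j * (x ⬝ᵥ u j) := by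
        rw [dotProduct_comm, Matrix.dotProduct_mulVec, ← Matrix.mulVec_transpose, hH.eq, hHu,
          smul_dotProduct, smul_eq_mul, dotProduct_comm]
      rw [this]; ring
    · simp [dotProduct_smul, dotProduct_comm x v]
      ring_nf
      simp
  have hvx : v ⬝ᵥ x = ∑ j, p j * (x ⬝ᵥ u j) := dgb_parseval u horth v x
  set P : ℝ := ∑ j, p j * (Z ⬝ᵥ u j) with hP
  have hvx2 : v ⬝ᵥ x = P - s / α := by
    rw [hvx]
    have : ∀ j, p j * (x ⬝ᵥ u j) = p j * (Z ⬝ᵥ u j) + s * (p j ^ 2 / μ j) := by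
      intro j; rw [hZc]; ring
    simp only [this, Finset.sum_add_distrib, ← Finset.mul_sum, hrel]
    ring
  have hq : ∑ j, μ j * (x ⬝ᵥ u j) ^ 2
      = ∑ j, μ j * (Z ⬝ᵥ u j) ^ 2 + 2 * s * P - s ^ 2 / α := by
    have : ∀ j, μ j * (x ⬝ᵥ u j) ^ 2
        = μ j * (Z ⬝ᵥ u j) ^ 2 + 2 * s * (p j * (Z ⬝ᵥ u j)) + s ^ 2 * (p j ^ 2 / μ j) := by
      intro j; rw [hZc]; have := hμ0 j; field_simp
      ring
    simp only [this, Finset.sum_add_distrib, ← Finset.mul_sum, hrel]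
    ring
  have hQ : x ⬝ᵥ ((H + α • vecMulVec v v) *ᵥ x)
      = ∑ j, μ j * (Z ⬝ᵥ u j) ^ 2 + α * P ^ 2 := by
    rw [hform, hq, hvx2]; field_simp; ring
  have hZZ : Z ⬝ᵥ Z ≤ L * (x ⬝ᵥ ((H + α • vecMulVec v v) *ᵥ x)) := by
    rw [hQ, dgb_parseval u horth Z Z]
    have h1 : ∑ j, (Z ⬝ᵥ u j) * (Z ⬝ᵥ u j) ≤ L * ∑ j, μ j * (Z ⬝ᵥ u j) ^ 2 := by
      rw [Finset.mul_sum]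
      refine Finset.sum_le_sum fun j _ => ?_
      by_cases hj : j = 0
      · subst hj; simp [hZ0]
      · have h2 : μ j = lam j := by simp [hμ, hj]
        have h3 : 1 ≤ L * lam j := by
          have := hLk j
          rwa [div_le_iff₀ (hlam j)] at this
        rw [h2]
        nlinarith [mul_le_mul_of_nonneg_right h3 (sq_nonneg (Z ⬝ᵥ u j))]
    have h4 : 0 ≤ L * (α * P ^ 2) := by positivity
    rw [mul_add]; linarith
  have hcoord : ∀ j, Z j ^ 2 ≤ Z ⬝ᵥ Z := by
    intro j
    have := Finset.single_le_sum (f := fun j => Z j * Z j)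
      (fun k _ => mul_self_nonneg _) (Finset.mem_univ j)
    rw [sq]; exact this
  have hterm : ∀ j, (x j - r j * x i) ^ 2 ≤ 2 * (1 + r j ^ 2) * (Z ⬝ᵥ Z) := by
    intro j
    have h1 : x j - r j * x i = Z j - r j * Z i := by
      simp only [hZ, hr, Pi.sub_apply, Pi.smul_apply, smul_eq_mul]
      field_simp
      ring
    rw [h1]
    nlinarith [hcoord j, mul_le_mul_of_nonneg_left (hcoord i) (sq_nonneg (r j)),
      sq_nonneg (Z j + r j * Z i)]
  have hsum : ∑ j ∈ Finset.univ.erase i, (x j - r j * x i) ^ 2 ≤ S * (Z ⬝ᵥ Z) := by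
    calc _ ≤ ∑ j, (x j - r j * x i) ^ 2 :=
          Finset.sum_le_sum_of_subset_of_nonneg (Finset.erase_subset _ _)
            (fun _ _ _ => sq_nonneg _)
      _ ≤ ∑ j, 2 * (1 + r j ^ 2) * (Z ⬝ᵥ Z) := Finset.sum_le_sum fun j _ => hterm j
      _ = _ := by rw [hS, Finset.sum_mul]
  rw [one_div_mul_eq_div, div_le_iff₀ (mul_pos hSpos hLpos)]
  nlinarith [mul_le_mul_of_nonneg_left hZZ hSpos.le]

/-- The box is contained in a ball of radius of order `e`. -/
lemma dgb_box {d : ℕ} [NeZero d]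
    (u : Fin d → Fin d → ℝ) (lam : Fin d → ℝ) (hlam : ∀ k, 0 < lam k)
    (horth : ∀ i j, u i ⬝ᵥ u j = if i = j then (1 : ℝ) else 0) (a : ℝ) (ha : 0 < a) :
    ∃ R : ℝ, 0 < R ∧ ∀ (e : ℝ) (x : Fin d → ℝ), 0 < e → |x ⬝ᵥ u 0| ≤ e →
      ∑ j ∈ Finset.univ.erase 0, lam j * (x ⬝ᵥ u j) ^ 2 ≤ (1 + a) * lam 0 * e ^ 2 →
      ∀ i, |x i| ≤ R * e := by
  set L : ℝ := ∑ k, 1 / lam k with hL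
  have hLk : ∀ k, 1 / lam k ≤ L := fun k =>
    Finset.single_le_sum (f := fun k => 1 / lam k)
      (fun k _ => (one_div_pos.mpr (hlam k)).le) (Finset.mem_univ k)
  have hLpos : 0 < L := lt_of_lt_of_le (one_div_pos.mpr (hlam 0)) (hLk 0)
  have hl0 := hlam 0
  refine ⟨1 + L * ((1 + a) * lam 0), by positivity, fun e x he h0 hb i => ?_⟩
  have hxx : x i ^ 2 ≤ x ⬝ᵥ x := by
    have := Finset.single_le_sum (f := fun j => x j * x j)
      (fun k _ => mul_self_nonneg _) (Finset.mem_univ i)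
    rw [sq]; exact this
  rw [dgb_parseval u horth x x, ← Finset.add_sum_erase _ _ (Finset.mem_univ (0 : Fin d))] at hxx
  have h1 : ∑ j ∈ Finset.univ.erase 0, (x ⬝ᵥ u j) * (x ⬝ᵥ u j)
      ≤ L * ∑ j ∈ Finset.univ.erase 0, lam j * (x ⬝ᵥ u j) ^ 2 := by
    rw [Finset.mul_sum]
    refine Finset.sum_le_sum fun j _ => ?_
    have h3 : 1 ≤ L * lam j := by
      have := hLk j
      rwa [div_le_iff₀ (hlam j)] at this
    nlinarith [mul_le_mul_of_nonneg_right h3 (sq_nonneg (x ⬝ᵥ u j))]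
  have h2 := mul_le_mul_of_nonneg_left hb hLpos.le
  have h3 : (x ⬝ᵥ u 0) ^ 2 ≤ e ^ 2 := sq_le_sq' (abs_le.mp h0).1 (abs_le.mp h0).2
  set T : ℝ := L * ((1 + a) * lam 0) with hT
  have hTpos : 0 < T := by positivity
  have h4 : x i ^ 2 ≤ (1 + T) * e ^ 2 := by
    have : L * ((1 + a) * lam 0 * e ^ 2) = T * e ^ 2 := by rw [hT]; ring
    nlinarith
  refine abs_le_of_sq_le_sq ?_ (by positivity)
  calc x i ^ 2 ≤ (1 + T) * e ^ 2 := h4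
    _ ≤ ((1 + T) * e) ^ 2 := by nlinarith [mul_pos hTpos (pow_pos he 2), sq_nonneg (T * e)]

/-- One-sided geometric bound. -/
lemma dgb_geom (q : ℝ) (hq0 : 0 ≤ q) (hq1 : q < 1) (S : Finset ℤ) (g : ℤ → ℕ)
    (hg : Set.InjOn g S) : ∑ k ∈ S, q ^ (g k) ≤ 1 / (1 - q) := by
  rw [← Finset.sum_image (f := fun n => q ^ n) hg, one_div, ← tsum_geometric_of_lt_one hq0 hq1]
  exact (summable_geometric_of_lt_one hq0 hq1).sum_le_tsum _ (fun _ _ => pow_nonneg hq0 _)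

/-- One-dimensional Gaussian sums, uniformly in the shift. -/
lemma dgb_one_dim (t : ℝ) (ht : 0 < t) (b : ℝ) (S : Finset ℤ) :
    ∑ k ∈ S, Real.exp (-(t ^ 2 * ((k : ℝ) - b) ^ 2)) ≤ 2 * Real.exp 1 * (1 + 1 / t) := by
  set q : ℝ := Real.exp (-t) with hq
  have hq0 : 0 ≤ q := (Real.exp_pos _).le
  have hq1 : q < 1 := by rw [hq, Real.exp_lt_one_iff]; linarith
  have hgeo : 1 / (1 - q) ≤ 1 + 1 / t := by
    have h1 : q * (1 + t) ≤ 1 := by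
      have h2 := Real.add_one_le_exp t
      have h3 : q * Real.exp t = 1 := by rw [hq, ← Real.exp_add]; simp
      nlinarith
    rw [div_le_iff₀ (by linarith)]
    have : (1 + 1 / t) * (1 - q) = (1 + t) * (1 - q) / t := by
      field_simp
      ring
    rw [this, le_div_iff₀ ht]
    nlinarith
  have hkey : ∀ (n : ℕ) (y : ℝ), (n : ℝ) ≤ |y| →
      Real.exp (-(t ^ 2 * y ^ 2)) ≤ Real.exp 1 * q ^ n := by
    intro n y hy
    rw [hq, ← Real.exp_nat_mul, ← Real.exp_add]
    apply Real.exp_le_exp.mpr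
    have h1 : t * n ≤ t * |y| := mul_le_mul_of_nonneg_left hy ht.le
    have h2 : t ^ 2 * y ^ 2 = (t * |y|) ^ 2 := by rw [mul_pow, sq_abs]
    rw [h2]
    nlinarith [sq_nonneg (t * |y| - 1), mul_nonneg ht.le (abs_nonneg y)]
  rw [← Finset.sum_filter_add_sum_filter_not S (fun k => k ≤ ⌊b⌋)]
  have hA : ∑ k ∈ S.filter (fun k => k ≤ ⌊b⌋), Real.exp (-(t ^ 2 * ((k : ℝ) - b) ^ 2))
      ≤ Real.exp 1 * (1 / (1 - q)) := by
    refine le_trans (Finset.sum_le_sum (g := fun k => Real.exp 1 * q ^ (⌊b⌋ - k).toNat) ?_) ?_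
    · intro k hk
      have hk' := (Finset.mem_filter.mp hk).2
      apply hkey
      have h1 : (((⌊b⌋ - k).toNat : ℤ) : ℝ) = ((⌊b⌋ - k : ℤ) : ℝ) := by
        rw [Int.toNat_of_nonneg (by omega)]
      rw [Int.cast_natCast] at h1
      rw [h1, abs_sub_comm]
      push_cast
      exact le_trans (by linarith [Int.floor_le b]) (le_abs_self _)
    · rw [← Finset.mul_sum]
      refine mul_le_mul_of_nonneg_left (dgb_geom q hq0 hq1 _ _ ?_) (Real.exp_pos _).le
      intro k hk l hl hkl
      have hk' := (Finset.mem_filter.mp hk).2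
      have hl' := (Finset.mem_filter.mp hl).2
      simp only at hkl
      omega
  have hB : ∑ k ∈ S.filter (fun k => ¬ k ≤ ⌊b⌋), Real.exp (-(t ^ 2 * ((k : ℝ) - b) ^ 2))
      ≤ Real.exp 1 * (1 / (1 - q)) := by
    refine le_trans (Finset.sum_le_sum (g := fun k => Real.exp 1 * q ^ (k - ⌊b⌋ - 1).toNat) ?_) ?_
    · intro k hk
      have hk' := (Finset.mem_filter.mp hk).2
      apply hkey
      have h1 : (((k - ⌊b⌋ - 1).toNat : ℤ) : ℝ) = ((k - ⌊b⌋ - 1 : ℤ) : ℝ) := by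
        rw [Int.toNat_of_nonneg (by omega)]
      rw [Int.cast_natCast] at h1
      rw [h1]
      push_cast
      exact le_trans (by linarith [Int.lt_floor_add_one b]) (le_abs_self _)
    · rw [← Finset.mul_sum]
      refine mul_le_mul_of_nonneg_left (dgb_geom q hq0 hq1 _ _ ?_) (Real.exp_pos _).le
      intro k hk l hl hkl
      have hk' := (Finset.mem_filter.mp hk).2
      have hl' := (Finset.mem_filter.mp hl).2
      simp only at hkl
      omega
  have := mul_le_mul_of_nonneg_left hgeo (Real.exp_pos 1).le
  linarith

/-- Summing a product bound: one free coordinate, the others Gaussian around a line. -/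
lemma dgb_multi {d : ℕ} (i : Fin d) (r : Fin d → ℝ) (t : ℝ) (ht : 0 < t) (S : Finset ℤ) :
    ∑ k ∈ Fintype.piFinset (fun _ : Fin d => S),
      Real.exp (-(t ^ 2 * ∑ j ∈ Finset.univ.erase i, ((k j : ℝ) - r j * k i) ^ 2)) ≤
      S.card * (2 * Real.exp 1 * (1 + 1 / t)) ^ (d - 1) := by
  set g : ℤ → Fin d → ℤ → ℝ := fun m j l =>
    if j = i then (if l = m then 1 else 0) else Real.exp (-(t ^ 2 * ((l : ℝ) - r j * m) ^ 2))
    with hg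
  have hg0 : ∀ m j l, 0 ≤ g m j l := by
    intro m j l
    simp only [hg]
    split_ifs <;> positivity
  have hle : ∀ k ∈ Fintype.piFinset (fun _ : Fin d => S),
      Real.exp (-(t ^ 2 * ∑ j ∈ Finset.univ.erase i, ((k j : ℝ) - r j * k i) ^ 2))
        ≤ ∑ m ∈ S, ∏ j, g m j (k j) := by
    intro k hk
    have hki : k i ∈ S := Fintype.mem_piFinset.mp hk i
    refine le_trans (le_of_eq ?_) (Finset.single_le_sum (f := fun m => ∏ j, g m j (k j))
      (fun m _ => Finset.prod_nonneg fun j _ => hg0 _ _ _) hki)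
    rw [← Finset.mul_prod_erase _ _ (Finset.mem_univ i)]
    have : g (k i) i (k i) = 1 := by simp [hg]
    rw [this, one_mul, Finset.mul_sum, ← Finset.sum_neg_distrib, Real.exp_sum]
    refine Finset.prod_congr rfl fun j hj => ?_
    have hj' : j ≠ i := Finset.ne_of_mem_erase hj
    simp [hg, hj']
  refine le_trans (Finset.sum_le_sum hle) ?_
  rw [Finset.sum_comm]
  refine le_trans (Finset.sum_le_card_nsmul _ _ ((2 * Real.exp 1 * (1 + 1 / t)) ^ (d - 1)) ?_)
    (le_of_eq (by rw [nsmul_eq_mul]))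
  intro m _
  rw [← Finset.prod_univ_sum (fun _ : Fin d => S) (fun j l => g m j l),
    ← Finset.mul_prod_erase _ _ (Finset.mem_univ i)]
  have h1 : ∑ l ∈ S, g m i l ≤ 1 := by
    simp only [hg, if_true, Finset.sum_ite_eq']
    split_ifs <;> norm_num
  have h2 : ∏ j ∈ Finset.univ.erase i, ∑ l ∈ S, g m j l
      ≤ (2 * Real.exp 1 * (1 + 1 / t)) ^ (d - 1) := by
    have h3 : ∏ j ∈ Finset.univ.erase i, ∑ l ∈ S, g m j l
        ≤ ∏ j ∈ Finset.univ.erase i, (2 * Real.exp 1 * (1 + 1 / t)) := by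
      refine Finset.prod_le_prod (fun j _ => Finset.sum_nonneg fun l _ => hg0 _ _ _) ?_
      intro j hj
      have hj' : j ≠ i := Finset.ne_of_mem_erase hj
      simp only [hg, hj', if_false]
      exact dgb_one_dim t ht _ S
    refine h3.trans (le_of_eq ?_)
    rw [Finset.prod_const, Finset.card_erase_of_mem (Finset.mem_univ i), Finset.card_univ,
      Fintype.card_fin]
  calc _ ≤ 1 * ∏ j ∈ Finset.univ.erase i, ∑ l ∈ S, g m j l :=
        mul_le_mul_of_nonneg_right h1
          (Finset.prod_nonneg fun j _ => Finset.sum_nonneg fun l _ => hg0 _ _ _)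
    _ ≤ _ := by rw [one_mul]; exact h2

/-- `1 / (N ε_N)` is bounded. -/
lemma dgb_eps (ε : ℕ → ℝ) (hε : ∀ N, 0 < ε N)
    (h1 : Tendsto (fun N : ℕ => (N : ℝ) * ε N ^ 2) atTop atTop)
    (h2 : Tendsto (fun N : ℕ => (N : ℝ) * ε N ^ 3) atTop (nhds 0)) :
    ∃ B : ℝ, ∀ N : ℕ, 1 ≤ N → 1 / ((N : ℝ) * ε N) ≤ B := by
  have e1 := h1.eventually_ge_atTop 1
  have e2 := h2.eventually_lt_const (zero_lt_one)
  obtain ⟨M, hM⟩ := eventually_atTop.mp (e1.and e2)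
  have hnn : ∀ n : ℕ, 0 ≤ 1 / ((n : ℝ) * ε n) := fun n => by
    have := hε n
    positivity
  refine ⟨1 + ∑ n ∈ Finset.range M, 1 / ((n : ℝ) * ε n), fun N hN => ?_⟩
  by_cases hNM : M ≤ N
  · obtain ⟨a1, a2⟩ := hM N hNM
    have he := hε N
    have hle : ε N ≤ 1 := by
      have : ε N * 1 ≤ ε N * ((N : ℝ) * ε N ^ 2) := mul_le_mul_of_nonneg_left a1 he.le
      nlinarith
    have hN0 : (0 : ℝ) < N := by exact_mod_cast hN
    have : 1 ≤ (N : ℝ) * ε N := by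
      have := mul_le_mul_of_nonneg_left hle (mul_pos hN0 he).le
      nlinarith
    have h3 : 1 / ((N : ℝ) * ε N) ≤ 1 := by
      rw [div_le_one (by positivity)]; exact this
    have h4 := Finset.sum_nonneg (s := Finset.range M) (fun n _ => hnn n)
    linarith
  · have := Finset.single_le_sum (f := fun n : ℕ => 1 / ((n : ℝ) * ε n)) (s := Finset.range M)
      (fun n _ => hnn n) (Finset.mem_range.mpr (not_le.mp hNM))
    linarith

/-- Paper's Corollary 3.5: uniform bound on degenerate-Gaussian sums over the
mesoscopic box `𝓒_N`:
`(1/(N ε_N)) N^{-(d-1)/2} ∑_{x ∈ 𝓒_N} e^{-(N/2) xᵀ(H + α v vᵀ)x} ≤ C₀`. -/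
theorem degenerate_gaussian_box_bound {d : ℕ} [NeZero d]
    (H : Matrix (Fin d) (Fin d) ℝ) (hH : H.IsSymm)
    (u : Fin d → Fin d → ℝ) (lam : Fin d → ℝ) (hlam : ∀ k, 0 < lam k)
    (horth : ∀ i j, u i ⬝ᵥ u j = if i = j then (1 : ℝ) else 0)
    (heig0 : H *ᵥ u 0 = (-(lam 0)) • u 0)
    (heig : ∀ k, k ≠ 0 → H *ᵥ u k = lam k • u k)
    (α : ℝ) (hα : 0 < α) (v : Fin d → ℝ) (hv1 : 0 < v ⬝ᵥ u 0)
    (hvrel : (v ⬝ᵥ u 0) ^ 2 / lam 0 =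
      ∑ k ∈ Finset.univ.erase 0, (v ⬝ᵥ u k) ^ 2 / lam k + 1 / α)
    (ε : ℕ → ℝ) (hε : ∀ N, 0 < ε N)
    (h1 : Tendsto (fun N : ℕ => (N : ℝ) * ε N ^ 2) atTop atTop)
    (h2 : Tendsto (fun N : ℕ => (N : ℝ) * ε N ^ 3) atTop (nhds 0))
    (a : ℝ) (ha : 0 < a) :
    ∃ C₀ : ℝ, ∀ N : ℕ, 1 ≤ N →
      1 / ((N : ℝ) * ε N) * (N : ℝ) ^ (-((d : ℝ) - 1) / 2) *
        ∑' x : {x : Fin d → ℝ //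
          (∀ i, ∃ k : ℤ, x i = k / N) ∧
          |x ⬝ᵥ u 0| ≤ ε N ∧
          ∑ j ∈ Finset.univ.erase 0, lam j * (x ⬝ᵥ u j) ^ 2 ≤
            (1 + a) * lam 0 * ε N ^ 2},
          Real.exp (-(N : ℝ) / 2 *
            (x.1 ⬝ᵥ ((H + α • vecMulVec v v) *ᵥ x.1))) ≤ C₀ := by
  obtain ⟨i, r, c, hc, hco⟩ :=
    dgb_coercive H hH u lam hlam horth heig0 heig α hα v hv1 hvrel
  obtain ⟨R, hR, hbox⟩ := dgb_box u lam hlam horth a ha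
  obtain ⟨B, hB⟩ := dgb_eps ε hε h1 h2
  set A : ℝ := 2 * Real.exp 1 * (1 + 1 / √(c / 2)) with hA
  have hsc : 0 < √(c / 2) := Real.sqrt_pos.mpr (by positivity)
  have hA0 : 0 ≤ A := by positivity
  refine ⟨(2 * R + B) * A ^ (d - 1), fun N hN => ?_⟩
  have hN0 : (0 : ℝ) < N := by exact_mod_cast hN
  have hN1 : (1 : ℝ) ≤ N := by exact_mod_cast hN
  have he := hε N
  have hNe : 0 < (N : ℝ) * ε N := mul_pos hN0 he
  have hsN : 0 < √(N : ℝ) := Real.sqrt_pos.mpr hN0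
  have hsN1 : 1 ≤ √(N : ℝ) := Real.one_le_sqrt.mpr hN1
  set t : ℝ := √(c / 2) / √(N : ℝ) with ht
  have ht0 : 0 < t := div_pos hsc hsN
  have ht2 : t ^ 2 = c / 2 / N := by
    rw [ht, div_pow, Real.sq_sqrt (by positivity), Real.sq_sqrt hN0.le]
  have htA : 2 * Real.exp 1 * (1 + 1 / t) ≤ A * √(N : ℝ) := by
    have : 1 / t = 1 / √(c / 2) * √(N : ℝ) := by
      rw [ht, one_div_div]; ring
    rw [this, hA, mul_assoc (2 * Real.exp 1)]
    have h20 : (0 : ℝ) ≤ 2 * Real.exp 1 := by positivity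
    refine mul_le_mul_of_nonneg_left ?_ h20
    rw [add_mul]; linarith
  set M : ℤ := ⌊R * (N * ε N)⌋ with hM
  have hM0 : 0 ≤ M := Int.floor_nonneg.mpr (by positivity)
  set S : Finset ℤ := Finset.Icc (-M) M with hS
  have hcard : (S.card : ℝ) ≤ 2 * R * (N * ε N) + 1 := by
    have h3 : (S.card : ℤ) = 2 * M + 1 := by
      rw [hS, Int.card_Icc, Int.toNat_of_nonneg (by omega)]; ring
    have h4 : (S.card : ℝ) = 2 * M + 1 := by exact_mod_cast h3
    rw [h4]
    linarith [Int.floor_le (R * (N * ε N))]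
  have hsum : (∑' x : {x : Fin d → ℝ //
          (∀ i, ∃ k : ℤ, x i = k / N) ∧
          |x ⬝ᵥ u 0| ≤ ε N ∧
          ∑ j ∈ Finset.univ.erase 0, lam j * (x ⬝ᵥ u j) ^ 2 ≤
            (1 + a) * lam 0 * ε N ^ 2},
          Real.exp (-(N : ℝ) / 2 *
            (x.1 ⬝ᵥ ((H + α • vecMulVec v v) *ᵥ x.1))))
      ≤ (2 * R * (N * ε N) + 1) * (A * √(N : ℝ)) ^ (d - 1) := by
    refine Real.tsum_le_of_sum_le (fun _ => (Real.exp_pos _).le) fun F => ?_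
    have hex : ∀ x : {x : Fin d → ℝ //
          (∀ i, ∃ k : ℤ, x i = k / N) ∧
          |x ⬝ᵥ u 0| ≤ ε N ∧
          ∑ j ∈ Finset.univ.erase 0, lam j * (x ⬝ᵥ u j) ^ 2 ≤
            (1 + a) * lam 0 * ε N ^ 2}, ∃ k : Fin d → ℤ, ∀ j, x.1 j = k j / N := fun x =>
      ⟨fun j => (x.2.1 j).choose, fun j => (x.2.1 j).choose_spec⟩
    choose κ hκ using hex
    have hinj : Function.Injective κ := by
      intro x y hxy
      apply Subtype.ext
      funext j
      rw [hκ, hκ, hxy]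
    have hmem : F.image κ ⊆ Fintype.piFinset (fun _ : Fin d => S) := by
      intro k hk
      obtain ⟨x, _, rfl⟩ := Finset.mem_image.mp hk
      rw [Fintype.mem_piFinset]
      intro j
      have h3 := hbox (ε N) x.1 he x.2.2.1 x.2.2.2 j
      rw [hκ, abs_div, abs_of_pos hN0, div_le_iff₀ hN0] at h3
      have h4 : |κ x j| ≤ M := by
        rw [hM, Int.le_floor]
        push_cast
        linarith
      rw [hS, Finset.mem_Icc]
      exact abs_le.mp h4
    set G : (Fin d → ℤ) → ℝ := fun k =>
      Real.exp (-(t ^ 2 * ∑ j ∈ Finset.univ.erase i, ((k j : ℝ) - r j * k i) ^ 2)) with hG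
    calc _ ≤ ∑ x ∈ F, G (κ x) := by
          refine Finset.sum_le_sum fun x _ => ?_
          apply Real.exp_le_exp.mpr
          have h3 := hco x.1
          have h4 : ∑ j ∈ Finset.univ.erase i, (x.1 j - r j * x.1 i) ^ 2
              = (∑ j ∈ Finset.univ.erase i, ((κ x j : ℝ) - r j * κ x i) ^ 2) / (N : ℝ) ^ 2 := by
            rw [Finset.sum_div]
            refine Finset.sum_congr rfl fun j _ => ?_
            rw [hκ, hκ]; field_simp
          rw [h4] at h3
          have h5 := mul_le_mul_of_nonneg_left h3 (by positivity : (0 : ℝ) ≤ N / 2)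
          have h6 : (N : ℝ) / 2 * (c * ((∑ j ∈ Finset.univ.erase i,
              ((κ x j : ℝ) - r j * κ x i) ^ 2) / (N : ℝ) ^ 2))
              = t ^ 2 * ∑ j ∈ Finset.univ.erase i, ((κ x j : ℝ) - r j * κ x i) ^ 2 := by
            generalize ∑ j ∈ Finset.univ.erase i, ((κ x j : ℝ) - r j * κ x i) ^ 2 = Y
            rw [ht2]; field_simp
          rw [h6] at h5
          linarith
      _ = ∑ k ∈ F.image κ, G k := (Finset.sum_image hinj.injOn).symm
      _ ≤ ∑ k ∈ Fintype.piFinset (fun _ : Fin d => S), G k :=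
          Finset.sum_le_sum_of_subset_of_nonneg hmem fun _ _ _ => (Real.exp_pos _).le
      _ ≤ S.card * (2 * Real.exp 1 * (1 + 1 / t)) ^ (d - 1) := dgb_multi i r t ht0 S
      _ ≤ _ := by
          refine mul_le_mul hcard (pow_le_pow_left₀ (by positivity) htA _) (by positivity)
            (by positivity)
  have hd : 1 ≤ d := Nat.one_le_iff_ne_zero.mpr (NeZero.ne d)
  have hpow : (N : ℝ) ^ (-((d : ℝ) - 1) / 2) * √(N : ℝ) ^ (d - 1) = 1 := by
    rw [Real.sqrt_eq_rpow, ← Real.rpow_natCast, ← Real.rpow_mul hN0.le, ← Real.rpow_add hN0,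
      Nat.cast_sub hd]
    have : -((d : ℝ) - 1) / 2 + 1 / 2 * ((d : ℝ) - (1 : ℕ)) = 0 := by push_cast; ring
    rw [this, Real.rpow_zero]
  have hpre : 0 ≤ 1 / ((N : ℝ) * ε N) * (N : ℝ) ^ (-((d : ℝ) - 1) / 2) := by positivity
  refine le_trans (mul_le_mul_of_nonneg_left hsum hpre) ?_
  have heq : 1 / ((N : ℝ) * ε N) * (N : ℝ) ^ (-((d : ℝ) - 1) / 2) *
      ((2 * R * (N * ε N) + 1) * (A * √(N : ℝ)) ^ (d - 1))
      = (1 / ((N : ℝ) * ε N) * (2 * R * (N * ε N) + 1)) * A ^ (d - 1) *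
        ((N : ℝ) ^ (-((d : ℝ) - 1) / 2) * √(N : ℝ) ^ (d - 1)) := by
    rw [mul_pow]; ring
  rw [heq, hpow, mul_one]
  refine mul_le_mul_of_nonneg_right ?_ (by positivity)
  have h7 : 1 / ((N : ℝ) * ε N) * (2 * R * (N * ε N) + 1) = 2 * R + 1 / ((N : ℝ) * ε N) := by
    field_simp
  rw [h7]
  linarith [hB N hN]
end
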